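/- arXiv:2604.12093 — 3 statements merged into one kernel-verified Lean document; each statement's English description precedes it below -/
import Mathlib

section
/- Assume: (i) sqrt(n)(hat_theta_n - theta_0) is bounded in probability; (ii) sup_{theta in cl(Theta)} |Gamma_n(theta) - Gamma(theta)| -> 0 in probability, where Gamma(theta) := -(Hessian of Y)(theta); (iii) sqrt(n) * sup_{theta in cl(Theta)} |Y_n(theta) - Y(theta)| is bounded in probability, where Y_n(omega, theta) := (1/n)(H_n(omega, theta) - H_n(omega, theta_0)); (iv) (1/n) * sup_{theta in cl(Theta)} |third-order derivative array of H_n(theta)| is bounded in probability. Then the sequence of random variables log( Integral_{Theta} exp(H_n(omega, theta)) pi(theta) d theta ) - H_n(omega, hat_theta_n(omega)) + (q/2) log n is bounded in probability; equivalently, (1/n) log Integral_{Theta} exp(H_n(theta)) pi(theta) d theta = (1/n) H_n(hat_theta_n) - (q/(2n)) log n + O_p(1/n) as n -> infinity. -/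
open MeasureTheory Filter Matrix

noncomputable section

/-- Convergence in probability of a sequence of real random variables to a constant. -/
def TendstoInProb {Ω : Type*} [MeasurableSpace Ω] (P : Measure Ω)
    (X : ℕ → Ω → ℝ) (c : ℝ) : Prop :=
  ∀ ε > 0, Tendsto (fun n => P {ω | ε < |X n ω - c|}) atTop (nhds 0)

/-- Boundedness in probability (`O_p(1)`) of a sequence of real random variables. -/
def BoundedInProb {Ω : Type*} [MeasurableSpace Ω] (P : Measure Ω)
    (X : ℕ → Ω → ℝ) : Prop :=
  ∀ ε > 0, ∃ M > 0, Filter.limsup (fun n => P {ω | M < |X n ω|}) atTop ≤ ENNReal.ofReal ε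

/-- The `i`-th standard basis vector of `R^q`. -/
def stdBasis (q : ℕ) (i : Fin q) : EuclideanSpace ℝ (Fin q) := EuclideanSpace.single i 1

/-- The `(i,j)` entry of the Hessian of `f` at `θ`. -/
def hessEntry (q : ℕ) (f : EuclideanSpace ℝ (Fin q) → ℝ)
    (θ : EuclideanSpace ℝ (Fin q)) (i j : Fin q) : ℝ :=
  iteratedFDeriv ℝ 2 f θ ![stdBasis q i, stdBasis q j]

/-- Frobenius norm of a `q × q` array. -/
def frobNorm (q : ℕ) (A : Fin q → Fin q → ℝ) : ℝ :=
  Real.sqrt (∑ i, ∑ j, (A i j) ^ 2)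

/-- Frobenius norm of the array of third-order partial derivatives of `f` at `θ`. -/
def thirdFrob (q : ℕ) (f : EuclideanSpace ℝ (Fin q) → ℝ)
    (θ : EuclideanSpace ℝ (Fin q)) : ℝ :=
  Real.sqrt (∑ i, ∑ j, ∑ k,
    (iteratedFDeriv ℝ 3 f θ ![stdBasis q i, stdBasis q j, stdBasis q k]) ^ 2)


lemma taylor_aux (g g' g'' : ℝ → ℝ) (C : ℝ)
    (h1 : ∀ t ∈ Set.Icc (0:ℝ) 1, HasDerivAt g (g' t) t)
    (h2 : ∀ t ∈ Set.Icc (0:ℝ) 1, HasDerivAt g' (g'' t) t)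
    (h0 : g' 0 = 0) (hC : ∀ t ∈ Set.Icc (0:ℝ) 1, g'' t ≤ C) : g 1 - g 0 ≤ C / 2 := by
  have hA : ∀ t ∈ Set.Icc (0:ℝ) 1, g' t ≤ C * t := by
    intro t ht
    have := Convex.image_sub_le_mul_sub_of_deriv_le (convex_Icc (0:ℝ) 1) (f := g')
      (fun x hx => (h2 x hx).continuousAt.continuousWithinAt)
      (fun x hx => (h2 x (interior_subset hx)).differentiableAt.differentiableWithinAt) (C := C)
      (fun x hx => by rw [(h2 x (interior_subset hx)).deriv]; exact hC x (interior_subset hx))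
      0 (by simp) t ht ht.1
    simpa [h0] using this
  have hd : ∀ t ∈ Set.Icc (0:ℝ) 1,
      HasDerivAt (fun t => g t - C / 2 * t ^ 2) (g' t - C / 2 * (2 * t)) t := by
    intro t ht
    have := (h1 t ht).fun_sub (((hasDerivAt_pow 2 t)).const_mul (C/2))
    simpa using this
  have := antitoneOn_of_deriv_nonpos (convex_Icc (0:ℝ) 1) (f := fun t => g t - C / 2 * t ^ 2)
      (fun x hx => (hd x hx).continuousAt.continuousWithinAt)
      (fun x hx => (hd x (interior_subset hx)).differentiableAt.differentiableWithinAt)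
      (fun x hx => by
        rw [(hd x (interior_subset hx)).deriv]
        have := hA x (interior_subset hx); linarith)
      (show (0:ℝ) ∈ Set.Icc (0:ℝ) 1 by simp) (show (1:ℝ) ∈ Set.Icc (0:ℝ) 1 by simp) (by norm_num)
  simp at this
  linarith

section line
variable {E : Type*} [NormedAddCommGroup E] [NormedSpace ℝ E]

lemma line_deriv1 {f : E → ℝ} {U : Set E} (hU : IsOpen U) (hf : ContDiffOn ℝ 2 f U)
    (x v : E) (t : ℝ) (ht : x + t • v ∈ U) :
    HasDerivAt (fun s : ℝ => f (x + s • v)) (fderiv ℝ f (x + t • v) v) t := by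
  have h1 : HasDerivAt (fun s : ℝ => x + s • v) v t := by
    simpa using ((hasDerivAt_id t).smul_const v).const_add x
  have h2 : DifferentiableAt ℝ f (x + t • v) :=
    (hf.differentiableOn (by norm_num)).differentiableAt (hU.mem_nhds ht)
  exact h2.hasFDerivAt.comp_hasDerivAt t h1

lemma line_deriv2 {f : E → ℝ} {U : Set E} (hU : IsOpen U) (hf : ContDiffOn ℝ 2 f U)
    (x v : E) (t : ℝ) (ht : x + t • v ∈ U) :
    HasDerivAt (fun s : ℝ => fderiv ℝ f (x + s • v) v)
      (fderiv ℝ (fderiv ℝ f) (x + t • v) v v) t := by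
  have h1 : HasDerivAt (fun s : ℝ => x + s • v) v t := by
    simpa using ((hasDerivAt_id t).smul_const v).const_add x
  have h2 : DifferentiableAt ℝ (fderiv ℝ f) (x + t • v) :=
    ((hf.fderiv_of_isOpen (m := 1) hU (by norm_num)).differentiableOn
      (by norm_num)).differentiableAt (hU.mem_nhds ht)
  have h3 := h2.hasFDerivAt.comp_hasDerivAt t h1
  have h4 := h3.clm_apply (hasDerivAt_const t v)
  simpa using h4

lemma quad_bounds {f : E → ℝ} {U B : Set E} (hU : IsOpen U) (hf : ContDiffOn ℝ 2 f U)
    (hB : Convex ℝ B) (hBU : B ⊆ U) {x y : E} (hx : x ∈ B) (hy : y ∈ B)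
    (h0 : fderiv ℝ f x = 0) (a b : ℝ)
    (hab : ∀ z ∈ B, ∀ v, a * ‖v‖ ^ 2 ≤ fderiv ℝ (fderiv ℝ f) z v v ∧
      fderiv ℝ (fderiv ℝ f) z v v ≤ b * ‖v‖ ^ 2) :
    a / 2 * ‖y - x‖ ^ 2 ≤ f y - f x ∧ f y - f x ≤ b / 2 * ‖y - x‖ ^ 2 := by
  have hmem : ∀ t ∈ Set.Icc (0:ℝ) 1, x + t • (y - x) ∈ B := by
    intro t ht
    exact hB.add_smul_sub_mem hx hy ht
  have e1 : x + (1:ℝ) • (y - x) = y := by simp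
  have e0 : x + (0:ℝ) • (y - x) = x := by simp
  have A := taylor_aux (fun s : ℝ => f (x + s • (y - x))) _ _ (b * ‖y - x‖ ^ 2)
    (fun t ht => line_deriv1 hU hf x (y - x) t (hBU (hmem t ht)))
    (fun t ht => line_deriv2 hU hf x (y - x) t (hBU (hmem t ht)))
    (by simp [h0]) (fun t ht => (hab _ (hmem t ht) _).2)
  have A' := taylor_aux (fun s : ℝ => - f (x + s • (y - x))) _ _ (- (a * ‖y - x‖ ^ 2))
    (fun t ht => (line_deriv1 hU hf x (y - x) t (hBU (hmem t ht))).neg)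
    (fun t ht => (line_deriv2 hU hf x (y - x) t (hBU (hmem t ht))).neg)
    (by simp [h0]) (fun t ht => neg_le_neg (hab _ (hmem t ht) _).1)
  simp only [e1, e0] at A A'
  constructor <;> linarith

lemma hess_neg {Y : E → ℝ} (hY : ContDiff ℝ 2 Y) {Θ : Set E} (hΘ : IsOpen Θ) {θ0 : E}
    (hθ0 : θ0 ∈ Θ) (hY0 : Y θ0 = 0) {χ : ℝ}
    (hneg : ∀ θ ∈ Θ, Y θ ≤ -χ * ‖θ - θ0‖ ^ 2) (v : E) :
    fderiv ℝ (fderiv ℝ Y) θ0 v v ≤ -(2 * χ) * ‖v‖ ^ 2 := by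
  by_contra hcon
  push Not at hcon
  have hd1 : ∀ t : ℝ, HasDerivAt (fun s : ℝ => Y (θ0 + s • v) + χ * ‖v‖ ^ 2 * s ^ 2)
      (fderiv ℝ Y (θ0 + t • v) v + χ * ‖v‖ ^ 2 * (2 * t)) t := fun t => by
    have := (line_deriv1 isOpen_univ hY.contDiffOn θ0 v t trivial).fun_add
      ((hasDerivAt_pow 2 t).const_mul (χ * ‖v‖ ^ 2))
    simpa using this
  have hd2 : HasDerivAt (fun t : ℝ => fderiv ℝ Y (θ0 + t • v) v + χ * ‖v‖ ^ 2 * (2 * t))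
      (fderiv ℝ (fderiv ℝ Y) (θ0 + (0:ℝ) • v) v v + χ * ‖v‖ ^ 2 * 2) 0 := by
    have := (line_deriv2 isOpen_univ hY.contDiffOn θ0 v 0 trivial).fun_add
      (((hasDerivAt_id (0:ℝ)).const_mul 2).const_mul (χ * ‖v‖ ^ 2))
    simpa using this
  set h := fun s : ℝ => Y (θ0 + s • v) + χ * ‖v‖ ^ 2 * s ^ 2 with hh
  have hderiv : deriv h = fun t => fderiv ℝ Y (θ0 + t • v) v + χ * ‖v‖ ^ 2 * (2 * t) :=
    funext fun t => (hd1 t).deriv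
  have hev : ∀ᶠ s in nhds (0:ℝ), h s ≤ h 0 := by
    have hc : ContinuousAt (fun s : ℝ => θ0 + s • v) 0 := by fun_prop
    have : ∀ᶠ s in nhds (0:ℝ), θ0 + s • v ∈ Θ :=
      hc.eventually_mem (hΘ.mem_nhds (by simpa using hθ0))
    filter_upwards [this] with s hs
    have := hneg _ hs
    simp only [add_sub_cancel_left, norm_smul, mul_pow, Real.norm_eq_abs, sq_abs] at this
    simp only [hh, zero_smul, add_zero, hY0]
    nlinarith
  have hmax : IsLocalMax h 0 := hev
  have hpos : 0 < deriv (deriv h) 0 := by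
    rw [hderiv, hd2.deriv, zero_smul, add_zero]; linarith
  have hmin := isLocalMin_of_deriv_deriv_pos hpos hmax.deriv_eq_zero (hd1 0).continuousAt
  have hconst : h =ᶠ[nhds 0] fun _ => h 0 := by
    filter_upwards [hmin, hmax] with s a b using le_antisymm b a
  have e1 := hconst.deriv.deriv.eq_of_nhds
  simp at e1
  exact hpos.ne' e1

lemma ev_norm_diff_lt {F : Type*} [NormedAddCommGroup F] {g : E → F} (hg : Continuous g)
    (θ0 : E) {δ : ℝ} (hδ : 0 < δ) : ∀ᶠ θ in nhds θ0, ‖g θ - g θ0‖ < δ := by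
  have h : Continuous fun θ => ‖g θ - g θ0‖ := (hg.sub continuous_const).norm
  exact h.continuousAt.eventually (gt_mem_nhds (by simpa using hδ))
end line

lemma le_biSup_aux {E : Type*} [TopologicalSpace E] {K : Set E} (hK : IsCompact K) {f : E → ℝ}
    (hf : ContinuousOn f K) (h0 : ∀ x, 0 ≤ f x) {x : E} (hx : x ∈ K) :
    f x ≤ ⨆ θ ∈ K, f θ := by
  obtain ⟨M, hM⟩ := hK.bddAbove_image hf
  have hM' : ∀ y ∈ K, f y ≤ M := fun y hy => hM ⟨y, hy, rfl⟩
  have hM0 : 0 ≤ M := (h0 x).trans (hM' x hx)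
  have : (⨆ (_ : x ∈ K), f x) = f x := by simp [hx]
  rw [← this]
  refine le_ciSup (f := fun y => ⨆ (_ : y ∈ K), f y) ⟨M, ?_⟩ x
  rintro _ ⟨y, rfl⟩
  exact Real.iSup_le (fun h => hM' y h) hM0

lemma quad_frob (q : ℕ) (L : EuclideanSpace ℝ (Fin q) →L[ℝ] EuclideanSpace ℝ (Fin q) →L[ℝ] ℝ)
    (v : EuclideanSpace ℝ (Fin q)) :
    |L v v| ≤ frobNorm q (fun i j => L (stdBasis q i) (stdBasis q j)) * ‖v‖ ^ 2 := by
  have hv : v = ∑ i, v i • stdBasis q i := by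
    have := (EuclideanSpace.basisFun (Fin q) ℝ).sum_repr v
    simpa [_root_.stdBasis] using this.symm
  have h1 : L v v = ∑ i, ∑ j, (v i * v j) * L (stdBasis q i) (stdBasis q j) := by
    conv_lhs => rw [hv]
    simp only [map_sum, map_smul, _root_.sum_apply, _root_.smul_apply,
      smul_eq_mul, Finset.mul_sum]
    rw [Finset.sum_comm]
    refine Finset.sum_congr rfl fun i _ => Finset.sum_congr rfl fun j _ => ?_
    ring
  have h2 : ‖v‖ ^ 2 = ∑ i, (v i) ^ 2 := by
    rw [EuclideanSpace.norm_sq_eq]; simp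
  rw [h1, frobNorm]
  simp only [← Fintype.sum_prod_type']
  have cs := Finset.sum_mul_sq_le_sq_mul_sq (Finset.univ : Finset (Fin q × Fin q))
    (fun p => v p.1 * v p.2) (fun p => L (stdBasis q p.1) (stdBasis q p.2))
  have h3 : ∑ p : Fin q × Fin q, (v p.1 * v p.2) ^ 2 = (‖v‖ ^ 2) ^ 2 := by
    rw [h2, sq (∑ i, (v i) ^ 2), Finset.sum_mul_sum, Fintype.sum_prod_type]
    simp [mul_pow]
  rw [h3] at cs
  apply abs_le_of_sq_le_sq _ (by positivity)
  rw [mul_pow, Real.sq_sqrt (Finset.sum_nonneg fun _ _ => sq_nonneg _)]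
  linarith

section ints
variable {q : ℕ}

lemma integrable_gauss {c : ℝ} (hc : 0 < c) :
    Integrable (fun v : EuclideanSpace ℝ (Fin q) => Real.exp (-c * ‖v‖ ^ 2)) := by
  by_contra h
  have h1 := GaussianFourier.integral_rexp_neg_mul_sq_norm (V := EuclideanSpace ℝ (Fin q)) hc
  rw [integral_undef h] at h1
  have : 0 < (Real.pi / c) ^ ((Module.finrank ℝ (EuclideanSpace ℝ (Fin q)) : ℝ) / 2) := by
    positivity
  linarith

lemma integrableOn_aux {Θ : Set (EuclideanSpace ℝ (Fin q))} (hb : Bornology.IsBounded Θ)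
    {f pri : EuclideanSpace ℝ (Fin q) → ℝ} (hf : ContinuousOn f (closure Θ))
    (hpri : Continuous pri) :
    IntegrableOn (fun θ => Real.exp (f θ) * pri θ) Θ := by
  have : IntegrableOn (fun θ => Real.exp (f θ) * pri θ) (closure Θ) :=
    ContinuousOn.integrableOn_compact hb.isCompact_closure
      ((Real.continuous_exp.comp_continuousOn hf).mul hpri.continuousOn)
  exact this.mono_set subset_closure

lemma log_upper {Θ : Set (EuclideanSpace ℝ (Fin q))} (ho : IsOpen Θ) (hb : Bornology.IsBounded Θ)
    {f pri : EuclideanSpace ℝ (Fin q) → ℝ} (hf : ContinuousOn f (closure Θ))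
    (hpri : Continuous pri) (hp0 : ∀ θ, 0 ≤ pri θ) {C : ℝ} (hC : 0 < C) (hpC : ∀ θ, pri θ ≤ C)
    {N c : ℝ} (hN : 0 < N) (hc : 0 < c) (m : EuclideanSpace ℝ (Fin q))
    (hq : ∀ θ ∈ Θ, f θ - f m ≤ -(N * c) * ‖θ - m‖ ^ 2)
    (hpos : 0 < ∫ θ in Θ, Real.exp (f θ) * pri θ) :
    Real.log (∫ θ in Θ, Real.exp (f θ) * pri θ) - f m + ((q : ℝ) / 2) * Real.log N
      ≤ Real.log C + (q : ℝ) / 2 * Real.log (Real.pi / c) := by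
  have hNc : 0 < N * c := by positivity
  have hgi : Integrable (fun θ : EuclideanSpace ℝ (Fin q) =>
      (Real.exp (f m) * C) * Real.exp (-(N * c) * ‖θ - m‖ ^ 2)) :=
    ((integrable_gauss hNc).comp_sub_right m).const_mul _
  have h1 : ∫ θ in Θ, Real.exp (f θ) * pri θ ≤
      (Real.exp (f m) * C) * (Real.pi / (N * c)) ^ ((q : ℝ) / 2) := by
    calc ∫ θ in Θ, Real.exp (f θ) * pri θ
        ≤ ∫ θ in Θ, (Real.exp (f m) * C) * Real.exp (-(N * c) * ‖θ - m‖ ^ 2) := by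
          refine setIntegral_mono_on (integrableOn_aux hb hf hpri) hgi.integrableOn
            ho.measurableSet fun θ hθ => ?_
          have := hq θ hθ
          calc Real.exp (f θ) * pri θ
              ≤ Real.exp (f m + -(N * c) * ‖θ - m‖ ^ 2) * C :=
                mul_le_mul (Real.exp_le_exp.2 (by linarith)) (hpC θ) (hp0 θ) (Real.exp_pos _).le
            _ = _ := by rw [Real.exp_add]; ring
      _ ≤ ∫ θ, (Real.exp (f m) * C) * Real.exp (-(N * c) * ‖θ - m‖ ^ 2) :=
          setIntegral_le_integral hgi (Eventually.of_forall fun θ => by positivity)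
      _ = _ := by
          rw [integral_const_mul, integral_sub_right_eq_self
            (fun θ : EuclideanSpace ℝ (Fin q) => Real.exp (-(N * c) * ‖θ‖ ^ 2)) m,
            GaussianFourier.integral_rexp_neg_mul_sq_norm hNc]
          simp
  have h2 := Real.log_le_log hpos h1
  rw [Real.log_mul (by positivity) (by positivity), Real.log_mul (by positivity) hC.ne',
    Real.log_exp, Real.log_rpow (by positivity), ← div_div, div_right_comm,
    Real.log_div (by positivity) hN.ne'] at h2
  linarith

lemma log_lower (hq1 : 1 ≤ q) {Θ : Set (EuclideanSpace ℝ (Fin q))}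
    (hb : Bornology.IsBounded Θ)
    {f pri : EuclideanSpace ℝ (Fin q) → ℝ} (hf : ContinuousOn f (closure Θ))
    (hpri : Continuous pri) (hp0 : ∀ θ, 0 ≤ pri θ) {N : ℝ} (hN : 0 < N) {p K : ℝ} (hp : 0 < p)
    (m : EuclideanSpace ℝ (Fin q)) (hsub : Metric.ball m (Real.sqrt N)⁻¹ ⊆ Θ)
    (hlow : ∀ θ ∈ Metric.ball m (Real.sqrt N)⁻¹, -K ≤ f θ - f m ∧ p ≤ pri θ) :
    0 < (∫ θ in Θ, Real.exp (f θ) * pri θ) ∧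
    Real.log p - K + Real.log (volume.real (Metric.ball (0 : EuclideanSpace ℝ (Fin q)) 1)) ≤
    Real.log (∫ θ in Θ, Real.exp (f θ) * pri θ) - f m + ((q : ℝ) / 2) * Real.log N := by
  have : Nonempty (Fin q) := ⟨⟨0, hq1⟩⟩
  have hs : 0 < Real.sqrt N := Real.sqrt_pos.2 hN
  set V := volume.real (Metric.ball (0 : EuclideanSpace ℝ (Fin q)) 1) with hV
  have hVpos : 0 < V :=
    ENNReal.toReal_pos (Metric.measure_ball_pos _ _ one_pos).ne' measure_ball_lt_top.ne
  have hvol : volume.real (Metric.ball m (Real.sqrt N)⁻¹) = (Real.sqrt N)⁻¹ ^ q * V := by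
    rw [hV, Measure.real, Measure.real, Measure.addHaar_ball _ _ (by positivity),
      ENNReal.toReal_mul, ENNReal.toReal_ofReal (by positivity)]
    simp
  have hint := integrableOn_aux hb hf hpri
  have h1 : Real.exp (f m - K) * p * ((Real.sqrt N)⁻¹ ^ q * V) ≤
      ∫ θ in Θ, Real.exp (f θ) * pri θ := by
    calc Real.exp (f m - K) * p * ((Real.sqrt N)⁻¹ ^ q * V)
        = ∫ θ in Metric.ball m (Real.sqrt N)⁻¹, Real.exp (f m - K) * p := by
          rw [setIntegral_const, hvol, smul_eq_mul]; ring
      _ ≤ ∫ θ in Metric.ball m (Real.sqrt N)⁻¹, Real.exp (f θ) * pri θ := by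
          refine setIntegral_mono_on (integrableOn_const measure_ball_lt_top.ne)
            (hint.mono_set hsub) measurableSet_ball fun θ hθ => ?_
          have := hlow θ hθ
          exact mul_le_mul (Real.exp_le_exp.2 (by linarith)) this.2 hp.le (Real.exp_pos _).le
      _ ≤ _ := setIntegral_mono_set hint
          (Eventually.of_forall fun θ => mul_nonneg (Real.exp_pos _).le (hp0 θ))
          (LE.le.eventuallyLE hsub)
  have h0 : 0 < Real.exp (f m - K) * p * ((Real.sqrt N)⁻¹ ^ q * V) := by positivity
  refine ⟨h0.trans_le h1, ?_⟩
  have h2 := Real.log_le_log h0 h1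
  rw [Real.log_mul (by positivity) (by positivity), Real.log_mul (by positivity) hp.ne',
    Real.log_exp, Real.log_mul (by positivity) hVpos.ne', Real.log_pow, Real.log_inv,
    Real.log_sqrt hN.le] at h2
  linarith
end ints

lemma frob_continuousOn (q : ℕ) {U : Set (EuclideanSpace ℝ (Fin q))} (hU : IsOpen U)
    {f Y : EuclideanSpace ℝ (Fin q) → ℝ} (hf : ContDiffOn ℝ 3 f U) (hY : ContDiff ℝ 2 Y)
    (a : ℝ) :
    ContinuousOn (fun θ => frobNorm q (fun i j =>
      (a * hessEntry q f θ i j) - (-(hessEntry q Y θ i j)))) U := by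
  have h1 : ContinuousOn (fderiv ℝ (fderiv ℝ f)) U :=
    ((hf.fderiv_of_isOpen (m := 2) hU (by norm_num)).fderiv_of_isOpen (m := 1) hU
      (by norm_num)).continuousOn
  have h2 : Continuous (fderiv ℝ (fderiv ℝ Y)) :=
    ((hY.fderiv_right (m := 1) (by norm_num)).fderiv_right (m := 0) (by norm_num)).continuous
  have h2' := h2.continuousOn (s := U)
  unfold frobNorm hessEntry
  simp only [iteratedFDeriv_two_apply]
  refine Real.continuous_sqrt.comp_continuousOn ?_
  refine continuousOn_finsetSum _ fun i _ => continuousOn_finsetSum _ fun j _ => ?_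
  fun_prop

/-- Theorem 3.1 (asymptotic expansion of the marginal quasi-log-likelihood):
`log ∫_Θ exp(Hₙ(θ)) π(θ) dθ = Hₙ(θ̂ₙ) - (q/2) log n + O_p(1)`. -/
theorem stmt0
    {Ω : Type*} [MeasurableSpace Ω] (P : Measure Ω) [IsProbabilityMeasure P]
    (q : ℕ) (hq : 1 ≤ q)
    (Θ : Set (EuclideanSpace ℝ (Fin q)))
    (hΘne : Θ.Nonempty) (hΘbdd : Bornology.IsBounded Θ) (hΘopen : IsOpen Θ)
    (hΘconv : Convex ℝ Θ)
    (H : ℕ → Ω → EuclideanSpace ℝ (Fin q) → ℝ)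
    (hHmeas : ∀ n, Measurable (fun p : Ω × EuclideanSpace ℝ (Fin q) => H n p.1 p.2))
    (hHsmooth : ∀ n ω, ∃ U : Set (EuclideanSpace ℝ (Fin q)),
      IsOpen U ∧ closure Θ ⊆ U ∧ ContDiffOn ℝ 3 (H n ω) U)
    (θhat : ℕ → Ω → EuclideanSpace ℝ (Fin q))
    (hθhatmeas : ∀ n, Measurable (θhat n))
    (hθhatmem : ∀ n ω, θhat n ω ∈ closure Θ)
    (hθhatmax : ∀ n ω, ∀ θ ∈ closure Θ, H n ω θ ≤ H n ω (θhat n ω))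
    (θ0 : EuclideanSpace ℝ (Fin q)) (hθ0 : θ0 ∈ Θ)
    (χ : ℝ) (hχ : 0 < χ)
    (Y : EuclideanSpace ℝ (Fin q) → ℝ) (hYsmooth : ContDiff ℝ 2 Y)
    (hY0 : Y θ0 = 0)
    (hYneg : ∀ θ ∈ Θ, Y θ ≤ -χ * ‖θ - θ0‖ ^ 2)
    (pri : EuclideanSpace ℝ (Fin q) → ℝ)
    (hpricont : Continuous pri) (hpribdd : ∃ C, ∀ θ, pri θ ≤ C)
    (hprinonneg : ∀ θ, 0 ≤ pri θ) (hpripos : 0 < pri θ0)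
    -- (i) √n (θ̂ₙ - θ₀) is bounded in probability
    (h1 : BoundedInProb P (fun n ω => Real.sqrt n * ‖θhat n ω - θ0‖))
    -- (ii) sup_{θ ∈ cl Θ} |Γₙ(θ) - Γ(θ)| → 0 in probability, Γ(θ) = -Hess Y(θ)
    (h2 : ∀ ε > 0, Tendsto (fun n : ℕ =>
      P {ω | ε < ⨆ θ ∈ closure Θ, frobNorm q (fun i j =>
        (-(1 / (n : ℝ)) * hessEntry q (H n ω) θ i j) - (-(hessEntry q Y θ i j)))})
      atTop (nhds 0))
    -- (iii) √n sup_{θ ∈ cl Θ} |Yₙ(θ) - Y(θ)| is bounded in probability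
    (h3 : BoundedInProb P (fun n ω =>
      Real.sqrt n * ⨆ θ ∈ closure Θ, |(1 / (n : ℝ)) * (H n ω θ - H n ω θ0) - Y θ|))
    -- (iv) (1/n) sup_{θ ∈ cl Θ} |∂³ Hₙ(θ)| is bounded in probability
    (h4 : BoundedInProb P (fun n ω => (1 / (n : ℝ)) * ⨆ θ ∈ closure Θ, thirdFrob q (H n ω) θ)) :
    BoundedInProb P (fun n ω =>
      Real.log (∫ θ in Θ, Real.exp (H n ω θ) * pri θ)
        - H n ω (θhat n ω) + ((q : ℝ) / 2) * Real.log n) := by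
  classical
  have hΔ : Continuous (fderiv ℝ (fderiv ℝ Y)) :=
    ((hYsmooth.fderiv_right (m := 1) (by norm_num)).fderiv_right (m := 0)
      (by norm_num)).continuous
  -- the neighbourhood of θ0
  have hev : ∀ᶠ θ in nhds θ0, θ ∈ Θ ∧
      ‖fderiv ℝ (fderiv ℝ Y) θ - fderiv ℝ (fderiv ℝ Y) θ0‖ < χ / 2 ∧ pri θ0 / 2 < pri θ := by
    refine (hΘopen.eventually_mem hθ0).and (Eventually.and ?_ ?_)
    · exact ev_norm_diff_lt (g := fderiv ℝ (fderiv ℝ Y)) hΔ θ0 (half_pos hχ)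
    · exact hpricont.continuousAt.eventually (lt_mem_nhds (by linarith))
  obtain ⟨r, hr, hball⟩ := Metric.eventually_nhds_iff_ball.1 hev
  obtain ⟨D, hD, hDist⟩ : ∃ D > 0, ∀ x ∈ closure Θ, ∀ y ∈ closure Θ, ‖x - y‖ ≤ D := by
    obtain ⟨D, hD⟩ := Metric.isBounded_iff.1 hΘbdd.closure
    refine ⟨max D 1, by positivity, fun x hx y hy => ?_⟩
    rw [← dist_eq_norm]
    exact (hD hx hy).trans (le_max_left _ _)
  obtain ⟨C, hC⟩ := hpribdd
  have hCpos : 0 < C := hpripos.trans_le (hC θ0)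
  obtain ⟨c, hcdef⟩ : ∃ c, c = min (χ / 2) (χ * r ^ 2 / (2 * D ^ 2)) := ⟨_, rfl⟩
  have hc : 0 < c := by rw [hcdef]; positivity
  have hc1 : c ≤ χ / 2 := hcdef ▸ min_le_left _ _
  have hc2 : c * D ^ 2 ≤ χ * r ^ 2 / 2 := by
    have : c ≤ χ * r ^ 2 / (2 * D ^ 2) := hcdef ▸ min_le_right _ _
    rw [le_div_iff₀ (by positivity)] at this
    linarith
  obtain ⟨K, hK⟩ : ∃ K, K = ‖fderiv ℝ (fderiv ℝ Y) θ0‖ + χ := ⟨_, rfl⟩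
  have hK0 : 0 ≤ K := by rw [hK]; positivity
  obtain ⟨b1, hb1⟩ : ∃ b, b = Real.log C + (q : ℝ) / 2 * Real.log (Real.pi / c) := ⟨_, rfl⟩
  obtain ⟨b2, hb2⟩ : ∃ b, b = Real.log (pri θ0 / 2) - K / 2 +
    Real.log (volume.real (Metric.ball (0 : EuclideanSpace ℝ (Fin q)) 1)) := ⟨_, rfl⟩
  have hYc : ∀ θ ∈ closure Θ, Y θ ≤ -χ * ‖θ - θ0‖ ^ 2 := by
    intro θ hθ
    exact closure_minimal (t := {θ | Y θ ≤ -χ * ‖θ - θ0‖ ^ 2}) hYneg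
      (isClosed_le hYsmooth.continuous (by fun_prop)) hθ
  have key : ∀ M1 M3 : ℝ, ∀ᶠ n : ℕ in atTop, ∀ ω,
      Real.sqrt n * ‖θhat n ω - θ0‖ ≤ M1 →
      (⨆ θ ∈ closure Θ, frobNorm q (fun i j =>
        (-(1 / (n : ℝ)) * hessEntry q (H n ω) θ i j) - (-(hessEntry q Y θ i j)))) ≤ χ / 2 →
      (Real.sqrt n * ⨆ θ ∈ closure Θ, |(1 / (n : ℝ)) * (H n ω θ - H n ω θ0) - Y θ|) ≤ M3 →
      |Real.log (∫ θ in Θ, Real.exp (H n ω θ) * pri θ)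
        - H n ω (θhat n ω) + ((q : ℝ) / 2) * Real.log n| ≤ |b1| + |b2| + 1 := by
    intro M1 M3
    have hsq : Tendsto (fun n : ℕ => Real.sqrt n) atTop atTop :=
      Real.tendsto_sqrt_atTop.comp tendsto_natCast_atTop_atTop
    filter_upwards [hsq.eventually_gt_atTop ((M1 + 1) / r),
      hsq.eventually_ge_atTop (M3 / (χ * r ^ 2 / 2)), eventually_ge_atTop 1] with n hn1 hn3 hn ω a1 a2 a3
    have hN : (0:ℝ) < n := by exact_mod_cast hn
    have hs : 0 < Real.sqrt n := Real.sqrt_pos.2 hN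
    have hss : Real.sqrt n * Real.sqrt n = n := Real.mul_self_sqrt hN.le
    rw [div_lt_iff₀ hr] at hn1
    rw [div_le_iff₀ (by positivity)] at hn3
    obtain ⟨U, hUo, hUc, hUs⟩ := hHsmooth n ω
    obtain ⟨f, hf⟩ : ∃ f, f = H n ω := ⟨_, rfl⟩
    obtain ⟨m, hm⟩ : ∃ m, m = θhat n ω := ⟨_, rfl⟩
    have hmc : m ∈ closure Θ := hm ▸ hθhatmem n ω
    have hmax : ∀ θ ∈ closure Θ, f θ ≤ f m := by rw [hf, hm]; exact hθhatmax n ω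
    rw [← hf] at hUs a2 a3 ⊢
    rw [← hm] at a1 ⊢
    have hfc : ContinuousOn f (closure Θ) := hUs.continuousOn.mono hUc
    have hcpt : IsCompact (closure Θ) := hΘbdd.isCompact_closure
    have hballΘ : Metric.ball θ0 r ⊆ Θ := fun z hz => (hball z hz).1
    have hballU : Metric.ball θ0 r ⊆ U := fun z hz => hUc (subset_closure (hballΘ hz))
    have hsmall : Metric.ball m (Real.sqrt n)⁻¹ ⊆ Metric.ball θ0 r := by
      apply Metric.ball_subset_ball'
      rw [dist_eq_norm]
      have : Real.sqrt n * ((Real.sqrt n)⁻¹ + ‖m - θ0‖) ≤ Real.sqrt n * r := by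
        rw [mul_add, mul_inv_cancel₀ hs.ne']; linarith
      exact le_of_mul_le_mul_left this hs
    have hmB : m ∈ Metric.ball θ0 r := hsmall (Metric.mem_ball_self (by positivity))
    have hgrad : fderiv ℝ f m = 0 := by
      apply IsLocalMax.fderiv_eq_zero
      filter_upwards [hΘopen.mem_nhds (hballΘ hmB)] with θ hθ using hmax θ (subset_closure hθ)
    have hhess : ∀ z ∈ Metric.ball θ0 r, ∀ v, -(n * K) * ‖v‖ ^ 2 ≤ fderiv ℝ (fderiv ℝ f) z v v ∧
        fderiv ℝ (fderiv ℝ f) z v v ≤ -(n * χ) * ‖v‖ ^ 2 := by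
      intro z hz v
      have e1 := (le_biSup_aux hcpt ((frob_continuousOn q hUo hUs hYsmooth (-(1 / (n:ℝ)))).mono hUc)
        (fun x => Real.sqrt_nonneg _) (subset_closure (hballΘ hz))).trans a2
      have e2 := quad_frob q (-(1 / (n:ℝ)) • fderiv ℝ (fderiv ℝ f) z + fderiv ℝ (fderiv ℝ Y) z) v
      have e3 : frobNorm q (fun i j => (-(1 / (n:ℝ)) • fderiv ℝ (fderiv ℝ f) z +
          fderiv ℝ (fderiv ℝ Y) z) (_root_.stdBasis q i) (_root_.stdBasis q j)) =
          frobNorm q (fun i j =>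
        (-(1 / (n : ℝ)) * hessEntry q f z i j) - (-(hessEntry q Y z i j))) := by
        congr 1
        ext i j
        simp [hessEntry, iteratedFDeriv_two_apply]
      rw [e3] at e2
      have e4 := e2.trans (mul_le_mul_of_nonneg_right e1 (by positivity))
      have e5 : |(fderiv ℝ (fderiv ℝ Y) z - fderiv ℝ (fderiv ℝ Y) θ0) v v| ≤ χ / 2 * ‖v‖ ^ 2 := by
        have h1 := (fderiv ℝ (fderiv ℝ Y) z - fderiv ℝ (fderiv ℝ Y) θ0).le_opNorm₂ v v
        have h2 := (hball z hz).2.1.le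
        rw [Real.norm_eq_abs] at h1
        refine h1.trans ?_
        rw [mul_assoc, ← sq]
        gcongr
      have e6 : |fderiv ℝ (fderiv ℝ Y) θ0 v v| ≤ ‖fderiv ℝ (fderiv ℝ Y) θ0‖ * ‖v‖ ^ 2 := by
        have h1 := (fderiv ℝ (fderiv ℝ Y) θ0).le_opNorm₂ v v
        rw [Real.norm_eq_abs] at h1
        linarith
      have e7 := hess_neg hYsmooth hΘopen hθ0 hY0 hYneg v
      have e8 : fderiv ℝ (fderiv ℝ f) z v v = n * ((1 / (n:ℝ)) * fderiv ℝ (fderiv ℝ f) z v v) := by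
        field_simp
      simp only [_root_.add_apply, _root_.sub_apply, _root_.smul_apply, smul_eq_mul] at e4 e5
      rw [abs_le] at e4 e5 e6
      rw [e8, hK]
      constructor
      · have : -((‖fderiv ℝ (fderiv ℝ Y) θ0‖ + χ) * ‖v‖ ^ 2) ≤
          1 / (n:ℝ) * fderiv ℝ (fderiv ℝ f) z v v := by linarith
        have := mul_le_mul_of_nonneg_left this hN.le
        linarith
      · have : 1 / (n:ℝ) * fderiv ℝ (fderiv ℝ f) z v v ≤ - (χ * ‖v‖ ^ 2) := by linarith
        have := mul_le_mul_of_nonneg_left this hN.le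
        linarith
    have hquad : ∀ θ ∈ Metric.ball θ0 r, _ := fun θ hθ =>
      quad_bounds hUo (hUs.of_le (by norm_num)) (convex_ball θ0 r) hballU hmB hθ hgrad _ _ hhess
    have hlow : ∀ θ ∈ Metric.ball m (Real.sqrt n)⁻¹, -(K / 2) ≤ f θ - f m ∧ pri θ0 / 2 ≤ pri θ := by
      intro θ hθ
      refine ⟨?_, (hball θ (hsmall hθ)).2.2.le⟩
      refine le_trans ?_ (hquad θ (hsmall hθ)).1
      rw [Metric.mem_ball, dist_eq_norm] at hθ
      have h1 : ‖θ - m‖ ^ 2 ≤ ((Real.sqrt n)⁻¹) ^ 2 := by gcongr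
      rw [inv_pow, Real.sq_sqrt hN.le] at h1
      have h2 : (n:ℝ) * ‖θ - m‖ ^ 2 ≤ 1 := by
        have := mul_le_mul_of_nonneg_left h1 hN.le
        rwa [mul_inv_cancel₀ hN.ne'] at this
      nlinarith
    have hup : ∀ θ ∈ Θ, f θ - f m ≤ -(n * c) * ‖θ - m‖ ^ 2 := by
      intro θ hθ
      by_cases hb : θ ∈ Metric.ball θ0 r
      · refine (hquad θ hb).2.trans ?_
        have : (n:ℝ) * c * ‖θ - m‖ ^ 2 ≤ n * (χ / 2) * ‖θ - m‖ ^ 2 := by gcongr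
        linarith
      · have hb' : r ≤ ‖θ - θ0‖ := by
          rw [Metric.mem_ball, dist_eq_norm] at hb; linarith
        have s1 := le_biSup_aux hcpt (f := fun θ => |(1 / (n : ℝ)) * (f θ - f θ0) - Y θ|)
          (((continuousOn_const.mul (hfc.sub continuousOn_const)).sub
            hYsmooth.continuous.continuousOn).abs) (fun x => abs_nonneg _) (subset_closure hθ)
        have s2 := (mul_le_mul_of_nonneg_left s1 hs.le).trans a3
        have s3 : |(1 / (n : ℝ)) * (f θ - f θ0) - Y θ| ≤ χ * r ^ 2 / 2 :=
          le_of_mul_le_mul_left (s2.trans hn3) hs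
        have s4 := (le_abs_self _).trans s3
        have s5 := hYneg θ hθ
        have s6 : χ * r ^ 2 ≤ χ * ‖θ - θ0‖ ^ 2 := by gcongr
        have s7 : (1 / (n : ℝ)) * (f θ - f θ0) ≤ - (c * D ^ 2) := by linarith
        have s8 : f θ - f θ0 ≤ - (n * (c * D ^ 2)) := by
          have := mul_le_mul_of_nonneg_left s7 hN.le
          rw [← mul_assoc, mul_one_div_cancel hN.ne'] at this
          linarith
        have s9 := hmax θ0 (subset_closure hθ0)
        have s10 : (n:ℝ) * (c * ‖θ - m‖ ^ 2) ≤ n * (c * D ^ 2) := by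
          have := hDist θ (subset_closure hθ) m hmc
          gcongr
        linarith
    obtain ⟨hpos, hlo⟩ := log_lower hq hΘbdd hfc hpricont hprinonneg hN (half_pos hpripos) m
      (hsmall.trans hballΘ) hlow
    have hhi := log_upper hΘopen hΘbdd hfc hpricont hprinonneg hCpos hC hN hc m hup hpos
    rw [← hb1] at hhi
    rw [← hb2] at hlo
    rw [abs_le]
    constructor
    · linarith [neg_abs_le b2, abs_nonneg b1]
    · linarith [le_abs_self b1, abs_nonneg b2]
  -- probability
  intro ε hε
  have hε3 : 0 < ε / 3 := by positivity
  have hlt : ENNReal.ofReal (ε / 4) < ENNReal.ofReal (ε / 3) :=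
    (ENNReal.ofReal_lt_ofReal_iff hε3).2 (by linarith)
  obtain ⟨M1, -, hM1⟩ := h1 (ε / 4) (by positivity)
  obtain ⟨M3, -, hM3⟩ := h3 (ε / 4) (by positivity)
  have p1 := eventually_lt_of_limsup_lt (hM1.trans_lt hlt)
  have p3 := eventually_lt_of_limsup_lt (hM3.trans_lt hlt)
  have p2 := (h2 (χ / 2) (by positivity)).eventually
    (gt_mem_nhds (ENNReal.ofReal_pos.2 hε3))
  refine ⟨|b1| + |b2| + 1, by positivity, ?_⟩
  refine limsup_le_of_le (by isBoundedDefault) ?_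
  filter_upwards [p1, p2, p3, key M1 M3] with n q1 q2 q3 hk
  refine (measure_mono (fun ω hω => ?_)).trans ((measure_union_le _ _).trans
    ((add_le_add ((measure_union_le _ _).trans (add_le_add q1.le q2.le)) q3.le).trans ?_))
  · by_contra hcon
    simp only [Set.mem_union, Set.mem_ofPred_eq, not_or, not_lt] at hcon hω
    obtain ⟨⟨w1, w2⟩, w3⟩ := hcon
    exact absurd hω (not_lt.2 (hk ω ((le_abs_self _).trans w1) w2 ((le_abs_self _).trans w3)))
  · rw [← ENNReal.ofReal_add hε3.le hε3.le, ← ENNReal.ofReal_add (by positivity) hε3.le]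
    exact ENNReal.ofReal_le_ofReal (by linarith)

end
end

section
/- Let P be a real symmetric q x q matrix with P^2 = P and rank P = d, where 1 <= d <= q. Then the pushforward of gamma_q under the map z -> z^T P z equals the chi-squared distribution with d degrees of freedom, i.e., the Gamma distribution on R with shape d/2 and rate 1/2. -/
open MeasureTheory Filter Matrix

noncomputable section

open ProbabilityTheory

lemma real_mul_cpow_aux {a : ℝ} (ha : 0 < a) (z r : ℂ) :
    ((a : ℂ) * z) ^ r = (a : ℂ) ^ r * z ^ r := by
  have ha' : (a : ℂ) ≠ 0 := by exact_mod_cast ha.ne'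
  rcases eq_or_ne r 0 with rfl | hr
  · simp
  rcases eq_or_ne z 0 with rfl | hz
  · simp [hr]
  rw [Complex.cpow_def_of_ne_zero (mul_ne_zero ha' hz), Complex.log_ofReal_mul ha hz,
    Complex.ofReal_log ha.le, add_mul, Complex.exp_add, ← Complex.cpow_def_of_ne_zero ha',
    ← Complex.cpow_def_of_ne_zero hz]

lemma factor_one (t : ℝ) :
    ∫ x : ℝ, Complex.exp (t * ((x ^ 2 : ℝ) : ℂ) * Complex.I) ∂(gaussianReal 0 1)
      = ((1 / 2 : ℝ) : ℂ) ^ (1 / 2 : ℂ) * (1 / (1 / 2 - t * Complex.I)) ^ (1 / 2 : ℂ) := by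
  rw [integral_gaussianReal_eq_integral_smul one_ne_zero]
  have hb : 0 < ((1 / 2 : ℂ) - t * Complex.I).re := by simp
  have h := integral_gaussian_complex hb
  have e : ∀ x : ℝ, gaussianPDFReal 0 1 x • Complex.exp (t * ((x ^ 2 : ℝ) : ℂ) * Complex.I)
      = ((√(2 * Real.pi))⁻¹ : ℂ) * Complex.exp (-((1 / 2 : ℂ) - t * Complex.I) * (x : ℂ) ^ 2) := by
    intro x
    simp only [gaussianPDFReal, Complex.real_smul]
    push_cast
    rw [mul_assoc, ← Complex.exp_add]
    congr 2
    · simp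
    · simp; ring
  simp_rw [e]
  rw [integral_const_mul, h, div_eq_mul_one_div, real_mul_cpow_aux Real.pi_pos,
    ← mul_assoc]
  congr 1
  have : (1 / 2 : ℂ) = ((1 / 2 : ℝ) : ℂ) := by simp
  rw [this, ← Complex.ofReal_cpow Real.pi_pos.le, ← Complex.ofReal_cpow (by norm_num),
    ← Real.sqrt_eq_rpow, ← Real.sqrt_eq_rpow, Real.sqrt_mul (by norm_num), Real.sqrt_div (by norm_num)]
  have := (Real.sqrt_pos.2 Real.pi_pos).ne'
  norm_cast
  field_simp
  simp

lemma complexMGF_gam_real (d : ℕ) (hd : 1 ≤ d) (t : ℝ) (ht : t < 1 / 2) :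
    complexMGF id (gammaMeasure ((d : ℝ) / 2) (1 / 2)) t
      = (((1 / 2 : ℝ) : ℂ) ^ (1 / 2 : ℂ) * (1 / (1 / 2 - (t : ℂ))) ^ (1 / 2 : ℂ)) ^ d := by
  have hd0 : (0 : ℝ) < d / 2 := by positivity
  have hb : 0 < 1 / 2 - t := by linarith
  have h := Complex.integral_cpow_mul_exp_neg_mul_Ioi (a := ((d / 2 : ℝ) : ℂ)) (by simpa using hd0) hb
  rw [complexMGF, gammaMeasure, integral_withDensity_eq_integral_toReal_smul
    (by unfold gammaPDF; fun_prop) (by simp [gammaPDF])]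
  have e : ∀ x : ℝ, (gammaPDF ((d : ℝ) / 2) (1 / 2) x).toReal • Complex.exp (t * (id x : ℝ))
     = (Set.Ici (0:ℝ)).indicator (fun x : ℝ => ((((1 / 2 : ℝ) ^ ((d : ℝ) / 2) / Real.Gamma (d / 2) : ℝ)) : ℂ) *
        ((x : ℂ) ^ (((d / 2 : ℝ) : ℂ) - 1) * Complex.exp (-(((1 / 2 - t : ℝ) : ℂ) * x)))) x := by
    intro x
    rw [gammaPDF, ENNReal.toReal_ofReal (gammaPDFReal_nonneg hd0 (by norm_num) x), gammaPDFReal]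
    by_cases hx : 0 ≤ x
    · rw [if_pos hx, Set.indicator_of_mem (by exact hx), Complex.real_smul, ← Complex.ofReal_one,
        ← Complex.ofReal_sub, ← Complex.ofReal_cpow hx]
      rw [Complex.ofReal_mul, Complex.ofReal_mul, mul_assoc, mul_assoc, Complex.ofReal_exp,
        ← Complex.exp_add]
      congr 3
      simp only [id]
      push_cast
      ring
    · rw [if_neg hx, Set.indicator_of_notMem (by exact hx), zero_smul]
  simp_rw [e]
  rw [integral_indicator measurableSet_Ici, integral_Ici_eq_integral_Ioi, integral_const_mul, h,
    Complex.Gamma_ofReal, mul_pow, ← Complex.cpow_nat_mul, ← Complex.cpow_nat_mul]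
  have : (d : ℂ) * (1 / 2) = ((d / 2 : ℝ) : ℂ) := by push_cast; ring
  rw [this, ← Complex.ofReal_cpow (by norm_num)]
  have hG : ((Real.Gamma (d / 2) : ℝ) : ℂ) ≠ 0 := by exact_mod_cast (Real.Gamma_pos_of_pos hd0).ne'
  have h2 : ((1 / 2 - t : ℝ) : ℂ) = 1 / 2 - (t : ℂ) := by push_cast; ring
  rw [Complex.ofReal_div, h2]
  field_simp

lemma charFun_gam (d : ℕ) (hd : 1 ≤ d) (t : ℝ) :
    charFun (gammaMeasure ((d : ℝ) / 2) (1 / 2)) t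
      = (((1 / 2 : ℝ) : ℂ) ^ (1 / 2 : ℂ) * (1 / (1 / 2 - t * Complex.I)) ^ (1 / 2 : ℂ)) ^ d := by
  set μ := gammaMeasure ((d : ℝ) / 2) (1 / 2) with hμ
  have hsub : Set.Iio (1 / 2 : ℝ) ⊆ interior (integrableExpSet id μ) := by
    refine interior_maximal (fun s hs => ?_) isOpen_Iio
    have hs' : s < 1 / 2 := hs
    by_contra hni
    have h0 : mgf id μ s = 0 := integral_undef hni
    have h1 := complexMGF_gam_real d hd s hs'
    rw [← hμ, complexMGF_ofReal, h0] at h1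
    have h2 : (1 / 2 - (s : ℂ)) ≠ 0 := by
      intro h
      have := congrArg Complex.re h
      simp at this
      linarith
    have h3 := (pow_eq_zero_iff (by omega)).1 (h1.symm.trans Complex.ofReal_zero)
    simp at h3
    exact h2 (by rw [← h3]; norm_num)
  have hA : AnalyticOnNhd ℂ (complexMGF id μ) {z : ℂ | z.re < 1 / 2} :=
    analyticOnNhd_complexMGF.mono fun z hz => hsub hz
  have hopen : IsOpen {z : ℂ | z.re < 1 / 2} := isOpen_lt Complex.continuous_re continuous_const
  have hB : AnalyticOnNhd ℂ (fun z : ℂ =>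
      (((1 / 2 : ℝ) : ℂ) ^ (1 / 2 : ℂ) * (1 / (1 / 2 - z)) ^ (1 / 2 : ℂ)) ^ d)
      {z : ℂ | z.re < 1 / 2} := by
    refine DifferentiableOn.analyticOnNhd (fun z hz => ?_) hopen
    have hre : 0 < (1 / 2 - z).re := by
      have : z.re < 1 / 2 := hz
      simp at this ⊢
      linarith
    have hne : (1 / 2 - z) ≠ 0 := fun h => by rw [h] at hre; simp at hre
    have hsl : 1 / (1 / 2 - z) ∈ Complex.slitPlane := by
      left
      rw [one_div, Complex.inv_re]
      exact div_pos hre (Complex.normSq_pos.2 hne)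
    refine DifferentiableAt.differentiableWithinAt ?_
    have hf : DifferentiableAt ℂ (fun z : ℂ => 1 / (1 / 2 - z)) z :=
      (differentiableAt_const _).div ((differentiableAt_const _).sub differentiableAt_id) hne
    have hg : DifferentiableAt ℂ (fun z : ℂ => (1 / (1 / 2 - z)) ^ (1 / 2 : ℂ)) z :=
      DifferentiableAt.cpow hf (differentiableAt_const _) hsl
    exact (hg.const_mul _).pow d
  have hE := AnalyticOnNhd.eqOn_of_preconnected_of_frequently_eq hA hB
    (convex_halfSpace_re_lt (1 / 2)).isPreconnected (z₀ := ((0 : ℝ) : ℂ)) (by simp) (by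
      have h_real : ∃ᶠ (x : ℝ) in nhdsWithin 0 {0}ᶜ, complexMGF id μ x =
          (((1 / 2 : ℝ) : ℂ) ^ (1 / 2 : ℂ) * (1 / (1 / 2 - (x : ℂ))) ^ (1 / 2 : ℂ)) ^ d := by
        refine Eventually.frequently ?_
        filter_upwards [mem_nhdsWithin_of_mem_nhds (Iio_mem_nhds (by norm_num : (0 : ℝ) < 1 / 2))]
          with x hx using complexMGF_gam_real d hd x hx
      rw [frequently_iff_seq_forall] at h_real ⊢
      obtain ⟨xs, hx_tendsto, hx_eq⟩ := h_real
      refine ⟨fun n ↦ xs n, ?_, fun n ↦ hx_eq n⟩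
      rw [tendsto_nhdsWithin_iff] at hx_tendsto ⊢
      exact ⟨(Complex.continuous_ofReal.tendsto 0).comp hx_tendsto.1, by simpa using hx_tendsto.2⟩)
  have h := hE (x := t * Complex.I) (by simp)
  rw [← complexMGF_id_mul_I]
  exact h

/-- If `P` is a symmetric idempotent `q × q` matrix of rank `d`, then the pushforward
of the standard Gaussian on `ℝ^q` under `z ↦ zᵀ P z` is the chi-squared distribution
with `d` degrees of freedom (the Gamma distribution with shape `d/2` and rate `1/2`). -/
theorem stmt15
    (q : ℕ) (hq : 1 ≤ q) (d : ℕ) (hd1 : 1 ≤ d) (hdq : d ≤ q)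
    (Pm : Matrix (Fin q) (Fin q) ℝ) (hsymm : Pmᵀ = Pm) (hidem : Pm * Pm = Pm)
    (hrank : Pm.rank = d) :
    Measure.map (fun z : Fin q → ℝ => ∑ i, ∑ j, z i * Pm i j * z j)
        (Measure.pi fun _ : Fin q => ProbabilityTheory.gaussianReal 0 1)
      = ProbabilityTheory.gammaMeasure ((d : ℝ) / 2) (1 / 2) := by
  have hH : Pm.IsHermitian := by simpa [Matrix.IsHermitian] using hsymm
  have hev : ∀ i, hH.eigenvalues i = 0 ∨ hH.eigenvalues i = 1 := fun i => by
    simpa using IsIdempotentElem.spectrum_subset ℝ (p := Pm) hidem (hH.eigenvalues_mem_spectrum_real i)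
  have hcard := hH.rank_eq_card_non_zero_eigs
  rw [hrank] at hcard
  set b := hH.eigenvectorBasis with hb
  -- rotation invariance
  have hrot : Measure.map (fun z : Fin q → ℝ => ∑ i, ∑ j, z i * Pm i j * z j)
        (Measure.pi fun _ : Fin q => gaussianReal 0 1)
      = Measure.map (fun z : Fin q → ℝ => ∑ i, hH.eigenvalues i * z i ^ 2)
        (Measure.pi fun _ : Fin q => gaussianReal 0 1) := by
    let Q : EuclideanSpace ℝ (Fin q) → ℝ := fun z => ∑ i, ∑ j, z i * Pm i j * z j
    have hQ : Measurable Q := by unfold Q; fun_prop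
    have h1 := map_pi_eq_stdGaussian (ι := Fin q)
    rw [stdGaussian_eq_map_pi_orthonormalBasis b] at h1
    have h2 := congrArg (Measure.map Q) h1
    rw [Measure.map_map hQ (by fun_prop), Measure.map_map hQ (by fun_prop)] at h2
    have e1 : (fun z : Fin q → ℝ => ∑ i, ∑ j, z i * Pm i j * z j) = Q ∘ WithLp.toLp 2 := rfl
    have e2 : (fun z : Fin q → ℝ => ∑ i, hH.eigenvalues i * z i ^ 2)
        = Q ∘ (fun x : Fin q → ℝ => ∑ i, x i • b i) := by
      ext x
      have hQv : ∀ v : EuclideanSpace ℝ (Fin q), Q v = inner ℝ v (WithLp.toLp 2 (Pm *ᵥ v.ofLp)) := by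
        intro v
        simp only [Q, PiLp.inner_apply, Matrix.mulVec, dotProduct, RCLike.inner_apply, conj_trivial,
          Finset.sum_mul]
        refine Finset.sum_congr rfl fun i _ => Finset.sum_congr rfl fun j _ => by ring
      have hP : WithLp.toLp 2 (Pm *ᵥ (∑ i, x i • b i).ofLp)
          = ∑ i, (hH.eigenvalues i * x i) • b i := by
        rw [WithLp.ofLp_sum, Matrix.mulVec_sum, WithLp.toLp_sum]
        refine Finset.sum_congr rfl fun i _ => ?_
        rw [WithLp.ofLp_smul, Matrix.mulVec_smul, hb, hH.mulVec_eigenvectorBasis, smul_smul,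
          mul_comm]
        rfl
      rw [Function.comp_apply, hQv, hP, b.orthonormal.inner_sum]
      refine Finset.sum_congr rfl fun i _ => ?_
      simp; ring
    rw [e1, e2, h2]
  rw [hrot]
  have : IsProbabilityMeasure (gammaMeasure ((d : ℝ) / 2) (1 / 2)) :=
    isProbabilityMeasure_gammaMeasure (by positivity) (by norm_num)
  have hm : Measurable (fun z : Fin q → ℝ => ∑ i, hH.eigenvalues i * z i ^ 2) := by fun_prop
  have := Measure.isProbabilityMeasure_map (μ := Measure.pi fun _ : Fin q => gaussianReal 0 1)
    hm.aemeasurable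
  apply Measure.ext_of_charFun
  ext t
  rw [charFun_gam d hd1, charFun_apply_real, integral_map hm.aemeasurable (by fun_prop)]
  have e : ∀ z : Fin q → ℝ, Complex.exp (t * ((∑ i, hH.eigenvalues i * z i ^ 2 : ℝ) : ℂ) * Complex.I)
      = ∏ i, Complex.exp (t * ((hH.eigenvalues i * z i ^ 2 : ℝ) : ℂ) * Complex.I) := by
    intro z
    rw [← Complex.exp_sum, Complex.ofReal_sum, Finset.mul_sum, Finset.sum_mul]
  simp_rw [e]
  rw [integral_fintype_prod_eq_prod
    (f := fun i (x : ℝ) => Complex.exp (t * ((hH.eigenvalues i * x ^ 2 : ℝ) : ℂ) * Complex.I))]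
  rw [← factor_one, hcard, Fintype.card_subtype, ← Finset.prod_const, Finset.prod_filter]
  refine Finset.prod_congr rfl fun i _ => ?_
  rcases hev i with h | h <;> simp [h]

end
end

section
/- Assume: (i) sqrt(n)(hat_theta_n - theta_0) is bounded in probability; (ii) sup_{theta in cl(Theta)} |Gamma_n(theta) - Gamma(theta)| -> 0 in probability, where Gamma(theta) := -(Hessian of Y)(theta); (iii) sqrt(n) * sup_{theta in cl(Theta)} |Y_n(theta) - Y(theta)| is bounded in probability, where Y_n(omega, theta) := (1/n)(H_n(omega, theta) - H_n(omega, theta_0)); (iv) (1/n) * sup_{theta in cl(Theta)} |third-order derivative array of H_n(theta)| is bounded in probability. Then Integral_{hat_U_n} hat_Z_n(u) * pi(hat_theta_n + n^{-1/2} u) du converges in probability to pi(theta_0) * (2 pi)^{q/2} * (det Gamma(theta_0))^{-1/2} as n -> infinity. -/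
open MeasureTheory Filter Matrix

noncomputable section

lemma biSup_le_aux {α : Type*} [TopologicalSpace α] {K : Set α} (hK : IsCompact K) {f : α → ℝ}
    (hf : ContinuousOn f K) {θ : α} (hθ : θ ∈ K) : f θ ≤ ⨆ θ ∈ K, f θ := by
  obtain ⟨C, hC⟩ := (hK.image_of_continuousOn hf).bddAbove
  have hb : BddAbove (Set.range fun θ => ⨆ (_ : θ ∈ K), f θ) := by
    refine ⟨max C 0, ?_⟩
    rintro _ ⟨x, rfl⟩
    by_cases hx : x ∈ K
    · simp only [hx, ciSup_unique]
      exact le_max_of_le_left (hC ⟨x, hx, rfl⟩)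
    · simp [hx]
  have h := le_ciSup hb θ
  simpa only [hθ, ciSup_unique] using h

lemma lagrange2 {E : Type*} [NormedAddCommGroup E] [NormedSpace ℝ E] {f : E → ℝ} {U : Set E}
    (hU : IsOpen U) (hf : ContDiffOn ℝ 2 f U) {t v : E}
    (hseg : ∀ s ∈ Set.Icc (0:ℝ) 1, t + s • v ∈ U) (ht : fderiv ℝ f t = 0) :
    ∃ ξ ∈ Set.Ioo (0:ℝ) 1, f (t + v) - f t = 1 / 2 * fderiv ℝ (fderiv ℝ f) (t + ξ • v) v v := by
  have hd : ∀ s : ℝ, HasDerivAt (fun s : ℝ => t + s • v) v s := fun s => by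
    simpa using ((hasDerivAt_id s).smul_const v).const_add t
  have h1 : ∀ s ∈ Set.Icc (0:ℝ) 1,
      HasDerivAt (fun s : ℝ => f (t + s • v)) (fderiv ℝ f (t + s • v) v) s := fun s hs => by
    have hx : DifferentiableAt ℝ f (t + s • v) :=
      ((hf.contDiffAt (hU.mem_nhds (hseg s hs))).differentiableAt (by norm_num))
    exact hx.hasFDerivAt.comp_hasDerivAt s (hd s)
  have h2 : ∀ s ∈ Set.Icc (0:ℝ) 1,
      HasDerivAt (fun s : ℝ => fderiv ℝ f (t + s • v) v)
        (fderiv ℝ (fderiv ℝ f) (t + s • v) v v) s := fun s hs => by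
    have hx : DifferentiableAt ℝ (fderiv ℝ f) (t + s • v) :=
      ((hf.contDiffAt (hU.mem_nhds (hseg s hs))).fderiv_right (m := 1) (by norm_num)).differentiableAt
        (by norm_num)
    have := hx.hasFDerivAt.comp_hasDerivAt s (hd s)
    simpa using this.clm_apply (hasDerivAt_const s v)
  obtain ⟨c, hc, hce⟩ := exists_ratio_hasDerivAt_eq_ratio_slope (fun s : ℝ => f (t + s • v))
    (fun s => fderiv ℝ f (t + s • v) v) (zero_lt_one) (fun s hs => (h1 s hs).continuousAt.continuousWithinAt)
    (fun s hs => h1 s (Set.Ioo_subset_Icc_self hs)) (fun s => s ^ 2) (fun s => 2 * s) (by fun_prop)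
    (fun s _ => by simpa using hasDerivAt_pow 2 s)
  obtain ⟨ξ, hξ, hξe⟩ := exists_hasDerivAt_eq_slope (fun s : ℝ => fderiv ℝ f (t + s • v) v)
    (fun s => fderiv ℝ (fderiv ℝ f) (t + s • v) v v) hc.1
    (fun s hs => (h2 s ⟨hs.1, hs.2.trans hc.2.le⟩).continuousAt.continuousWithinAt)
    (fun s hs => h2 s ⟨hs.1.le, hs.2.le.trans hc.2.le⟩)
  refine ⟨ξ, ⟨hξ.1, hξ.2.trans hc.2⟩, ?_⟩
  have hc0 : c ≠ 0 := hc.1.ne'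
  simp only [zero_smul, add_zero, one_smul, ht, _root_.zero_apply] at hce hξe
  rw [hξe]
  field_simp
  linarith

lemma hess_expand (q : ℕ) (f : EuclideanSpace ℝ (Fin q) → ℝ) (θ u : EuclideanSpace ℝ (Fin q)) :
    fderiv ℝ (fderiv ℝ f) θ u u = ∑ i, ∑ j, u i * u j * hessEntry q f θ i j := by
  have hu : u = ∑ i, u i • _root_.stdBasis q i := by
    simpa [_root_.stdBasis] using ((EuclideanSpace.basisFun (Fin q) ℝ).sum_repr u).symm
  conv_lhs => rw [hu]
  simp only [map_sum, map_smul, _root_.sum_apply, _root_.smul_apply,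
    hessEntry, iteratedFDeriv_two_apply, smul_eq_mul, Matrix.cons_val_zero, Matrix.cons_val_one]
  simp only [Finset.mul_sum]
  rw [Finset.sum_comm]
  refine Finset.sum_congr rfl fun i _ => Finset.sum_congr rfl fun j _ => by ring

lemma frob_bound (q : ℕ) (A : Fin q → Fin q → ℝ) (u : EuclideanSpace ℝ (Fin q)) :
    |∑ i, ∑ j, u i * u j * A i j| ≤ frobNorm q A * ‖u‖ ^ 2 := by
  have h1 : (∑ i, ∑ j, u i * u j * A i j) = ∑ p : Fin q × Fin q, (u p.1 * u p.2) * A p.1 p.2 := by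
    rw [Fintype.sum_prod_type]
  have h2 : ∑ p : Fin q × Fin q, (u p.1 * u p.2) ^ 2 = (‖u‖ ^ 2) ^ 2 := by
    rw [Fintype.sum_prod_type, EuclideanSpace.norm_sq_eq, sq (∑ i, _), Finset.sum_mul_sum]
    simp [mul_pow]
  have h3 : ∑ p : Fin q × Fin q, (A p.1 p.2) ^ 2 = frobNorm q A ^ 2 := by
    rw [Fintype.sum_prod_type, frobNorm, Real.sq_sqrt (by positivity)]
  have := Finset.sum_mul_sq_le_sq_mul_sq Finset.univ
    (fun p : Fin q × Fin q => u p.1 * u p.2) (fun p => A p.1 p.2)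
  rw [h2, h3, ← h1] at this
  have h0 : 0 ≤ frobNorm q A := Real.sqrt_nonneg _
  apply abs_le_of_sq_le_sq _ (by positivity) 
  linarith [mul_pow (frobNorm q A) (‖u‖^2) 2]

open scoped MatrixOrder in
lemma gauss_int (q : ℕ) (A : Matrix (Fin q) (Fin q) ℝ) (hA : A.PosDef) :
    ∫ u : EuclideanSpace ℝ (Fin q), Real.exp (-(1/2) * (∑ i, ∑ j, u i * u j * A i j)) =
      (2 * Real.pi) ^ ((q : ℝ) / 2) * A.det ^ (-(1 : ℝ) / 2) := by
  obtain ⟨B, hB⟩ := CStarAlgebra.nonneg_iff_eq_star_mul_self.mp hA.posSemidef.nonneg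
  have hdet : A.det = B.det ^ 2 := by
    rw [hB, Matrix.det_mul, Matrix.star_eq_conjTranspose, Matrix.det_conjTranspose]
    simp [sq]
  have hB0 : B.det ≠ 0 := fun h => by
    have := hA.det_pos; rw [hdet, h] at this; simp at this
  set L := Matrix.toEuclideanLin B with hL
  have hLdet : LinearMap.det L = B.det := by
    rw [hL, Matrix.toEuclideanLin_eq_toLin, LinearMap.det_toLin]
  have hq : ∀ u : EuclideanSpace ℝ (Fin q), ∑ i, ∑ j, u i * u j * A i j = ‖L u‖ ^ 2 := by
    intro u
    have e1 : ∑ i, ∑ j, u i * u j * A i j = u.ofLp ⬝ᵥ A *ᵥ u.ofLp := by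
      simp only [dotProduct, Matrix.mulVec, Finset.mul_sum]
      refine Finset.sum_congr rfl fun i _ => Finset.sum_congr rfl fun j _ => by ring
    have e2 : ‖L u‖ ^ 2 = (B *ᵥ u.ofLp) ⬝ᵥ (B *ᵥ u.ofLp) := by
      rw [EuclideanSpace.norm_sq_eq, hL]
      simp [dotProduct, sq, Matrix.toLpLin_apply]
    rw [e1, e2, hB, ← Matrix.mulVec_mulVec, Matrix.dotProduct_mulVec, Matrix.star_eq_conjTranspose,
      Matrix.vecMul_conjTranspose]
    simp
  simp only [hq]
  have hne : LinearMap.det L ≠ 0 := by rwa [hLdet]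
  have hmap := Measure.map_linearMap_addHaar_eq_smul_addHaar
    (volume : Measure (EuclideanSpace ℝ (Fin q))) hne
  have hLc : Continuous L := L.continuous_of_finiteDimensional
  have hint := integral_map (μ := (volume : Measure (EuclideanSpace ℝ (Fin q)))) hLc.aemeasurable
    (f := fun v => Real.exp (-(1/2) * ‖v‖ ^ 2)) (by
      apply Continuous.aestronglyMeasurable; fun_prop)
  rw [← hint, hmap, integral_smul_measure, GaussianFourier.integral_rexp_neg_mul_sq_norm (by norm_num),
    ENNReal.toReal_ofReal (abs_nonneg _), hLdet, hdet]
  have : (B.det ^ 2) ^ (-(1:ℝ)/2) = |B.det⁻¹| := by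
    rw [← sq_abs, ← Real.rpow_natCast, ← Real.rpow_mul (abs_nonneg _), abs_inv]
    norm_num
    exact Real.rpow_neg_one _
  rw [this, finrank_euclideanSpace_fin, smul_eq_mul, mul_comm]
  congr 2
  ring

lemma hess_close (q : ℕ) {Θ U : Set (EuclideanSpace ℝ (Fin q))} (hΘbdd : Bornology.IsBounded Θ)
    {h Y : EuclideanSpace ℝ (Fin q) → ℝ} (hU : IsOpen U) (hΘU : closure Θ ⊆ U)
    (hh : ContDiffOn ℝ 3 h U) (hY : ContDiff ℝ 2 Y) {n : ℕ} (hn : 0 < n) {η : ℝ}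
    (hη : (⨆ θ ∈ closure Θ, frobNorm q (fun i j =>
        (-(1 / (n : ℝ)) * hessEntry q h θ i j) - (-(hessEntry q Y θ i j)))) ≤ η)
    {θ : EuclideanSpace ℝ (Fin q)} (hθ : θ ∈ closure Θ) (v : EuclideanSpace ℝ (Fin q)) :
    |fderiv ℝ (fderiv ℝ h) θ v v - n * fderiv ℝ (fderiv ℝ Y) θ v v| ≤ n * η * ‖v‖ ^ 2 := by
  have hK : IsCompact (closure Θ) := hΘbdd.isCompact_closure
  have ch : ContinuousOn (fderiv ℝ (fderiv ℝ h)) U := by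
    have e1 : ContDiffOn ℝ 2 (fderiv ℝ h) U := hh.fderiv_of_isOpen hU (by norm_num)
    have e2 : ContDiffOn ℝ 1 (fderiv ℝ (fderiv ℝ h)) U := e1.fderiv_of_isOpen hU (by norm_num)
    exact e2.continuousOn
  have cY : Continuous (fderiv ℝ (fderiv ℝ Y)) :=
    (hY.fderiv_right (m := 1) (by norm_num)).continuous_fderiv (by norm_num)
  have hcont : ContinuousOn (fun θ => frobNorm q (fun i j =>
        (-(1 / (n : ℝ)) * hessEntry q h θ i j) - (-(hessEntry q Y θ i j)))) (closure Θ) := by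
    unfold frobNorm hessEntry
    simp only [iteratedFDeriv_two_apply]
    have ch' := ch.mono hΘU
    apply ContinuousOn.sqrt
    refine continuousOn_finsetSum _ fun i _ => continuousOn_finsetSum _ fun j _ => ?_
    have k1 := (ch'.clm_apply (continuousOn_const (c := _root_.stdBasis q i))).clm_apply
      (continuousOn_const (c := _root_.stdBasis q j))
    have k2 := (cY.continuousOn (s := closure Θ)).clm_apply
      (continuousOn_const (c := _root_.stdBasis q i)) |>.clm_apply
      (continuousOn_const (c := _root_.stdBasis q j))
    exact ((continuousOn_const.mul k1).sub k2.neg).pow 2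
  have hle := (biSup_le_aux hK hcont hθ).trans hη
  have hb := (frob_bound q (fun i j =>
        (-(1 / (n : ℝ)) * hessEntry q h θ i j) - (-(hessEntry q Y θ i j))) v).trans
        (mul_le_mul_of_nonneg_right hle (sq_nonneg ‖v‖))
  have hn' : (0:ℝ) < n := by exact_mod_cast hn
  have he : fderiv ℝ (fderiv ℝ h) θ v v - n * fderiv ℝ (fderiv ℝ Y) θ v v
      = -(n * ∑ i, ∑ j, v i * v j * ((-(1 / (n : ℝ)) * hessEntry q h θ i j) -
        (-(hessEntry q Y θ i j)))) := by
    rw [hess_expand, hess_expand]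
    simp only [Finset.mul_sum, ← Finset.sum_sub_distrib, ← Finset.sum_neg_distrib]
    refine Finset.sum_congr rfl fun i _ => Finset.sum_congr rfl fun j _ => ?_
    field_simp
    ring
  rw [he, abs_neg, abs_mul, abs_of_pos hn', mul_assoc]
  exact mul_le_mul_of_nonneg_left hb hn'.le

lemma Y_hess_neg {E : Type*} [NormedAddCommGroup E] [NormedSpace ℝ E] {Θ : Set E}
    (hΘ : IsOpen Θ) {θ0 : E} (hθ0 : θ0 ∈ Θ) {χ : ℝ} (hχ : 0 < χ) {Y : E → ℝ}
    (hY : ContDiff ℝ 2 Y) (hY0 : Y θ0 = 0) (hYneg : ∀ θ ∈ Θ, Y θ ≤ -χ * ‖θ - θ0‖ ^ 2) (u : E) :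
    fderiv ℝ (fderiv ℝ Y) θ0 u u ≤ -(2 * χ) * ‖u‖ ^ 2 := by
  have cY : Continuous (fderiv ℝ (fderiv ℝ Y)) :=
    (hY.fderiv_right (m := 1) (by norm_num)).continuous_fderiv (by norm_num)
  have hmax : IsLocalMax Y θ0 := by
    filter_upwards [hΘ.mem_nhds hθ0] with x hx
    rw [hY0]
    refine (hYneg x hx).trans ?_
    nlinarith [sq_nonneg ‖x - θ0‖]
  have hd := hmax.fderiv_eq_zero
  by_contra! hcon
  have hc : Continuous (fun s : ℝ => fderiv ℝ (fderiv ℝ Y) (θ0 + s • u) u u) := by fun_prop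
  have hev : ∀ᶠ s in nhds (0:ℝ), -(2 * χ) * ‖u‖ ^ 2 < fderiv ℝ (fderiv ℝ Y) (θ0 + s • u) u u := by
    apply hc.continuousAt.eventually (lt_mem_nhds _)
    simpa using hcon
  have hev2 : ∀ᶠ s in nhds (0:ℝ), θ0 + s • u ∈ Θ := by
    have : Continuous (fun s : ℝ => θ0 + s • u) := by fun_prop
    apply this.continuousAt.eventually (hΘ.mem_nhds _)
    simpa using hθ0
  obtain ⟨ε, hε, hball⟩ := Metric.eventually_nhds_iff.mp (hev.and hev2)
  set s : ℝ := ε / 2 with hs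
  have hs0 : 0 < s := by positivity
  obtain ⟨ξ, hξ, he⟩ := lagrange2 (t := θ0) (v := s • u) isOpen_univ hY.contDiffOn
    (fun _ _ => Set.mem_univ _) hd
  have hb1 := (hball (y := ξ * s) (by
    rw [Real.dist_eq, sub_zero, abs_of_pos (mul_pos hξ.1 hs0)]
    nlinarith [hξ.2])).1
  have hb2 := (hball (y := s) (by
    rw [Real.dist_eq, sub_zero, abs_of_pos hs0]; linarith)).2
  have hy := hYneg _ hb2
  rw [hY0, sub_zero] at he
  rw [he, smul_smul] at hy
  simp only [map_smul, _root_.smul_apply, smul_eq_mul, add_sub_cancel_left, norm_smul,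
    Real.norm_eq_abs, mul_pow, sq_abs] at hy
  nlinarith [mul_lt_mul_of_pos_left hb1 (pow_pos hs0 2)]

lemma quad_bound (q : ℕ) {Θ U : Set (EuclideanSpace ℝ (Fin q))} (hΘbdd : Bornology.IsBounded Θ)
    {h Y : EuclideanSpace ℝ (Fin q) → ℝ} (hU : IsOpen U) (hΘU : closure Θ ⊆ U)
    (hh : ContDiffOn ℝ 3 h U) (hY : ContDiff ℝ 2 Y) {n : ℕ} (hn : 0 < n) {χ δ D B : ℝ}
    (hχ : 0 < χ) (hδ : 0 < δ) (hD : 0 < D)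
    (h2 : (⨆ θ ∈ closure Θ, frobNorm q (fun i j =>
        (-(1 / (n : ℝ)) * hessEntry q h θ i j) - (-(hessEntry q Y θ i j)))) ≤ χ / 2)
    {θ0 t : EuclideanSpace ℝ (Fin q)} (hθ0 : θ0 ∈ Θ)
    (hYneg : ∀ θ ∈ Θ, Y θ ≤ -χ * ‖θ - θ0‖ ^ 2)
    (hball : Metric.closedBall θ0 δ ⊆ Θ)
    (hYδ : ∀ θ ∈ Metric.closedBall θ0 δ, ∀ u, fderiv ℝ (fderiv ℝ Y) θ u u ≤ -χ * ‖u‖ ^ 2)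
    (ht : t ∈ Metric.closedBall θ0 δ) (htf : fderiv ℝ h t = 0)
    (htmax : ∀ θ ∈ closure Θ, h θ ≤ h t)
    (hdiam : ∀ x ∈ Θ, ∀ y ∈ Θ, ‖x - y‖ ≤ D)
    (h3 : (⨆ θ ∈ closure Θ, |(1 / (n : ℝ)) * (h θ - h θ0) - Y θ|) ≤ B)
    (hB : B ≤ χ * δ ^ 2 / 2) {θ : EuclideanSpace ℝ (Fin q)} (hθ : θ ∈ Θ) :
    h θ - h t ≤ -(n * min (χ / 4) (χ * δ ^ 2 / (2 * D ^ 2)) * ‖θ - t‖ ^ 2) := by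
  have hn' : (0:ℝ) < n := by exact_mod_cast hn
  set c := min (χ / 4) (χ * δ ^ 2 / (2 * D ^ 2)) with hc
  by_cases hin : θ ∈ Metric.closedBall θ0 δ
  · have hseg : ∀ s ∈ Set.Icc (0:ℝ) 1, t + s • (θ - t) ∈ Metric.closedBall θ0 δ := fun s hs =>
      (convex_closedBall θ0 δ).add_smul_sub_mem ht hin hs
    obtain ⟨ξ, hξ, he⟩ := lagrange2 (t := t) (v := θ - t) hU (hh.of_le (by norm_num))
      (fun s hs => hΘU (subset_closure (hball (hseg s hs)))) htf
    have hm := hseg ξ (Set.Ioo_subset_Icc_self hξ)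
    have k1 := hYδ _ hm (θ - t)
    have k2 := (abs_le.mp (hess_close q hΘbdd hU hΘU hh hY hn h2
      (subset_closure (hball hm)) (θ - t))).2
    rw [add_sub_cancel] at he
    rw [he]
    have k3 : c * (n * ‖θ - t‖ ^ 2) ≤ χ / 4 * (n * ‖θ - t‖ ^ 2) :=
      mul_le_mul_of_nonneg_right (min_le_left _ _) (by positivity)
    have k4 := mul_le_mul_of_nonneg_left k1 hn'.le
    linarith
  · have hK : IsCompact (closure Θ) := hΘbdd.isCompact_closure
    have hcont : ContinuousOn (fun θ => |(1 / (n : ℝ)) * (h θ - h θ0) - Y θ|) (closure Θ) := by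
      have := hh.continuousOn.mono hΘU
      have := hY.continuous
      fun_prop
    have k1 := (abs_le.mp (((biSup_le_aux hK hcont (subset_closure hθ)).trans h3))).2
    have k2 := hYneg θ hθ
    have k3 := htmax θ0 (subset_closure hθ0)
    have k4 : δ < ‖θ - θ0‖ := by
      simpa [dist_eq_norm] using hin
    have k5 : δ ^ 2 ≤ ‖θ - θ0‖ ^ 2 := by gcongr
    have k6 : (1 / (n : ℝ)) * (h θ - h θ0) ≤ - (χ * δ ^ 2 / 2) := by nlinarith
    have k7 : h θ - h θ0 ≤ n * - (χ * δ ^ 2 / 2) := by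
      rw [one_div, inv_mul_le_iff₀ hn'] at k6; exact k6
    have k8 : ‖θ - t‖ ^ 2 ≤ D ^ 2 := by
      gcongr; exact hdiam θ hθ t (hball ht)
    have k9 : c * ‖θ - t‖ ^ 2 ≤ χ * δ ^ 2 / 2 := by
      calc c * ‖θ - t‖ ^ 2 ≤ (χ * δ ^ 2 / (2 * D ^ 2)) * D ^ 2 := by
            gcongr; exact min_le_right _ _
        _ = _ := by field_simp
    have k10 := mul_le_mul_of_nonneg_left k9 hn'.le
    linarith

lemma ev_norm_sub {E F : Type*} [NormedAddCommGroup E] [NormedAddCommGroup F] {f : E → F}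
    (h : Continuous f) (x : E) (χ : ℝ) (hχ : 0 < χ) : ∀ᶠ θ in nhds x, ‖f θ - f x‖ < χ := by
  have cn : Continuous fun θ => ‖f θ - f x‖ := (h.sub continuous_const).norm
  exact cn.continuousAt.eventually (gt_mem_nhds (by simpa using hχ))

lemma local_ball {E : Type*} [NormedAddCommGroup E] [NormedSpace ℝ E] {Θ : Set E}
    (hΘopen : IsOpen Θ) {θ0 : E} (hθ0 : θ0 ∈ Θ) {χ : ℝ} (hχ : 0 < χ) {Y : E → ℝ}
    (cY : Continuous (fderiv ℝ (fderiv ℝ Y)))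
    (hQ : ∀ u, fderiv ℝ (fderiv ℝ Y) θ0 u u ≤ -(2 * χ) * ‖u‖ ^ 2) :
    ∃ δ > 0, Metric.closedBall θ0 δ ⊆ Θ ∧
      ∀ θ ∈ Metric.closedBall θ0 δ, ∀ u, fderiv ℝ (fderiv ℝ Y) θ u u ≤ -χ * ‖u‖ ^ 2 := by
  have e1 : ∀ᶠ θ in nhds θ0, ‖fderiv ℝ (fderiv ℝ Y) θ - fderiv ℝ (fderiv ℝ Y) θ0‖ < χ := by
    exact @ev_norm_sub E (E →L[ℝ] E →L[ℝ] ℝ) _ _ _ cY θ0 χ hχ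
  obtain ⟨δ, hδ, hb⟩ := Metric.nhds_basis_closedBall.eventually_iff.mp
    (e1.and (hΘopen.mem_nhds hθ0))
  refine ⟨δ, hδ, fun x hx => (hb hx).2, fun θ hθ u => ?_⟩
  have k1 := (hb hθ).1
  have k2 := (fderiv ℝ (fderiv ℝ Y) θ - fderiv ℝ (fderiv ℝ Y) θ0).le_opNorm₂ u u
  rw [_root_.sub_apply, _root_.sub_apply, Real.norm_eq_abs] at k2
  have k3 := (abs_le.mp k2).2
  have k4 : ‖fderiv ℝ (fderiv ℝ Y) θ - fderiv ℝ (fderiv ℝ Y) θ0‖ * ‖u‖ * ‖u‖ ≤ χ * ‖u‖ * ‖u‖ := by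
    gcongr
  have k5 := hQ u
  nlinarith

lemma pointwise_lim (q : ℕ) {Θ : Set (EuclideanSpace ℝ (Fin q))}
    (hΘbdd : Bornology.IsBounded Θ) (hΘopen : IsOpen Θ)
    {h : ℕ → EuclideanSpace ℝ (Fin q) → ℝ} {Y : EuclideanSpace ℝ (Fin q) → ℝ}
    (hh : ∀ k, ∃ U : Set (EuclideanSpace ℝ (Fin q)),
      IsOpen U ∧ closure Θ ⊆ U ∧ ContDiffOn ℝ 3 (h k) U) (hY : ContDiff ℝ 2 Y) {n : ℕ → ℕ}
    {r η : ℕ → ℝ} (hn : ∀ᶠ k in atTop, 0 < n k)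
    (hr : Tendsto r atTop (nhds 0)) (hnr : ∀ᶠ k in atTop, n k * r k ^ 2 = 1)
    (hη : Tendsto η atTop (nhds 0))
    (h2 : ∀ k, (⨆ θ ∈ closure Θ, frobNorm q (fun i j =>
        (-(1 / (n k : ℝ)) * hessEntry q (h k) θ i j) - (-(hessEntry q Y θ i j)))) ≤ η k)
    {θ0 : EuclideanSpace ℝ (Fin q)} (hθ0 : θ0 ∈ Θ)
    {t : ℕ → EuclideanSpace ℝ (Fin q)} (ht : Tendsto t atTop (nhds θ0))
    (htf : ∀ᶠ k in atTop, fderiv ℝ (h k) (t k) = 0) (u : EuclideanSpace ℝ (Fin q)) :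
    Tendsto (fun k => h k (t k + r k • u) - h k (t k)) atTop
      (nhds (1 / 2 * fderiv ℝ (fderiv ℝ Y) θ0 u u)) := by
  have cY : Continuous (fderiv ℝ (fderiv ℝ Y)) :=
    (hY.fderiv_right (m := 1) (by norm_num)).continuous_fderiv (by norm_num)
  rw [Metric.tendsto_nhds]
  intro ε hε
  have hc : Continuous (fun θ => fderiv ℝ (fderiv ℝ Y) θ u u) := by fun_prop
  have e1 : ∀ᶠ θ in nhds θ0, |fderiv ℝ (fderiv ℝ Y) θ u u - fderiv ℝ (fderiv ℝ Y) θ0 u u| < ε :=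
    Metric.tendsto_nhds.mp hc.continuousAt ε hε
  obtain ⟨ρ, hρ, hball⟩ := Metric.eventually_nhds_iff_ball.mp (e1.and (hΘopen.mem_nhds hθ0))
  have e2 : ∀ᶠ k in atTop, t k ∈ Metric.ball θ0 ρ := ht (Metric.ball_mem_nhds θ0 hρ)
  have e3 : ∀ᶠ k in atTop, t k + r k • u ∈ Metric.ball θ0 ρ := by
    have : Tendsto (fun k => t k + r k • u) atTop (nhds θ0) := by
      simpa using ht.add (hr.smul_const u)
    exact this (Metric.ball_mem_nhds θ0 hρ)
  have e4 : ∀ᶠ k in atTop, η k * ‖u‖ ^ 2 < ε := by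
    have : Tendsto (fun k => η k * ‖u‖ ^ 2) atTop (nhds 0) := by
      simpa using hη.mul_const (‖u‖ ^ 2)
    exact this.eventually (gt_mem_nhds hε)
  filter_upwards [e2, e3, e4, hn, hnr, htf] with k e2 e3 e4 hn hnr htf
  obtain ⟨U, hU, hΘU, hhk⟩ := hh k
  have hseg : ∀ s ∈ Set.Icc (0:ℝ) 1, t k + s • (r k • u) ∈ Metric.ball θ0 ρ := fun s hs =>
    (convex_ball θ0 ρ).add_smul_mem e2 e3 hs
  obtain ⟨ξ, hξ, he⟩ := lagrange2 (t := t k) (v := r k • u) hU (hhk.of_le (by norm_num))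
    (fun s hs => hΘU (subset_closure (hball _ (hseg s hs)).2)) htf
  have hm := hball _ (hseg ξ (Set.Ioo_subset_Icc_self hξ))
  have k2 := hess_close q hΘbdd hU hΘU hhk hY hn (h2 k) (subset_closure hm.2) (r k • u)
  have k1 := hm.1
  rw [Real.dist_eq, he]
  set θ' := t k + ξ • r k • u
  simp only [map_smul, _root_.smul_apply, smul_eq_mul, norm_smul, Real.norm_eq_abs, mul_pow, sq_abs]
    at k2 ⊢
  have k3 : (n k : ℝ) * (r k * (r k * fderiv ℝ (fderiv ℝ Y) θ' u u))
    = fderiv ℝ (fderiv ℝ Y) θ' u u := by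
    linear_combination (fderiv ℝ (fderiv ℝ Y) θ' u u) * hnr
  have k4 : (n k : ℝ) * η k * (r k ^ 2 * ‖u‖ ^ 2) = η k * ‖u‖ ^ 2 := by
    linear_combination (η k * ‖u‖ ^ 2) * hnr
  rw [k3, k4] at k2
  rw [abs_lt] at k1 ⊢
  rw [abs_le] at k2
  constructor <;> linarith [k1.1, k1.2, k2.1, k2.2]

lemma seq_lemma (q : ℕ)
    (Θ : Set (EuclideanSpace ℝ (Fin q)))
    (hΘbdd : Bornology.IsBounded Θ) (hΘopen : IsOpen Θ)
    (h : ℕ → EuclideanSpace ℝ (Fin q) → ℝ) (hmeas : ∀ k, Measurable (h k))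
    (hh : ∀ k, ∃ U : Set (EuclideanSpace ℝ (Fin q)),
      IsOpen U ∧ closure Θ ⊆ U ∧ ContDiffOn ℝ 3 (h k) U)
    (t : ℕ → EuclideanSpace ℝ (Fin q))
    (htmax : ∀ k, ∀ θ ∈ closure Θ, h k θ ≤ h k (t k))
    (θ0 : EuclideanSpace ℝ (Fin q)) (hθ0 : θ0 ∈ Θ)
    (χ : ℝ) (hχ : 0 < χ)
    (Y : EuclideanSpace ℝ (Fin q) → ℝ) (hY : ContDiff ℝ 2 Y)
    (hY0 : Y θ0 = 0)
    (hYneg : ∀ θ ∈ Θ, Y θ ≤ -χ * ‖θ - θ0‖ ^ 2)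
    (pri : EuclideanSpace ℝ (Fin q) → ℝ)
    (hpricont : Continuous pri) (hpribdd : ∃ C, ∀ θ, pri θ ≤ C)
    (hprinonneg : ∀ θ, 0 ≤ pri θ)
    (n : ℕ → ℕ) (hn : Tendsto n atTop atTop) (M : ℝ) (η : ℕ → ℝ) (hη : Tendsto η atTop (nhds 0))
    (h1 : ∀ k, Real.sqrt (n k) * ‖t k - θ0‖ ≤ M)
    (h2 : ∀ k, (⨆ θ ∈ closure Θ, frobNorm q (fun i j =>
        (-(1 / (n k : ℝ)) * hessEntry q (h k) θ i j) - (-(hessEntry q Y θ i j)))) ≤ η k)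
    (h3 : ∀ k, Real.sqrt (n k) *
      (⨆ θ ∈ closure Θ, |(1 / (n k : ℝ)) * (h k θ - h k θ0) - Y θ|) ≤ M) :
    Tendsto (fun k =>
      ∫ u in {u : EuclideanSpace ℝ (Fin q) |
            t k + ((n k : ℝ) ^ (-(1 : ℝ) / 2)) • u ∈ Θ},
        Real.exp (h k (t k + ((n k : ℝ) ^ (-(1 : ℝ) / 2)) • u) - h k (t k)) *
          pri (t k + ((n k : ℝ) ^ (-(1 : ℝ) / 2)) • u)) atTop
      (nhds (pri θ0 * (2 * Real.pi) ^ ((q : ℝ) / 2) *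
        (Matrix.det (Matrix.of fun i j => -(hessEntry q Y θ0 i j))) ^ (-(1 : ℝ) / 2))) := by
  have cY : Continuous (fderiv ℝ (fderiv ℝ Y)) :=
    (hY.fderiv_right (m := 1) (by norm_num)).continuous_fderiv (by norm_num)
  obtain ⟨C, hC⟩ := hpribdd
  have hC0 : 0 ≤ C := (hprinonneg θ0).trans (hC θ0)
  set r : ℕ → ℝ := fun k => (n k : ℝ) ^ (-(1 : ℝ) / 2) with hrdef
  have hnr' : Tendsto (fun k => (n k : ℝ)) atTop atTop := tendsto_natCast_atTop_atTop.comp hn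
  have hr : Tendsto r atTop (nhds 0) := by
    have := (tendsto_rpow_neg_atTop (y := 1/2) (by norm_num)).comp hnr'
    refine this.congr fun k => ?_
    simp only [hrdef, Function.comp]
    norm_num
  have hnpos : ∀ᶠ k in atTop, 0 < n k := hn.eventually_gt_atTop 0
  have hrs : ∀ k, 0 < n k → r k * Real.sqrt (n k) = 1 := fun k hk => by
    have : (0:ℝ) < n k := by exact_mod_cast hk
    rw [Real.sqrt_eq_rpow, hrdef, ← Real.rpow_add this]
    norm_num
  have hr0 : ∀ k, 0 ≤ r k := fun k => Real.rpow_nonneg (Nat.cast_nonneg _) _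
  have hnr2 : ∀ᶠ k in atTop, (n k : ℝ) * r k ^ 2 = 1 := by
    filter_upwards [hnpos] with k hk
    have e := hrs k hk
    calc (n k : ℝ) * r k ^ 2 = (r k * Real.sqrt (n k)) ^ 2 := by
          rw [mul_pow, Real.sq_sqrt (Nat.cast_nonneg _)]; ring
      _ = 1 := by rw [e]; norm_num
  have hmul : ∀ k x, 0 < n k → Real.sqrt (n k) * x ≤ M → x ≤ r k * M := fun k x hk hx => by
    have := mul_le_mul_of_nonneg_left hx (hr0 k)
    rwa [← mul_assoc, hrs k hk, one_mul] at this
  have hrM : Tendsto (fun k => r k * M) atTop (nhds 0) := by simpa using hr.mul_const M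
  have ht : Tendsto t atTop (nhds θ0) := by
    rw [tendsto_iff_norm_sub_tendsto_zero]
    refine squeeze_zero' (Eventually.of_forall fun k => norm_nonneg _) ?_ hrM
    filter_upwards [hnpos] with k hk
    exact hmul k _ hk (h1 k)
  have hQ := Y_hess_neg hΘopen hθ0 hχ hY hY0 hYneg
  -- local ball
  obtain ⟨δ, hδ, hball, hYδ⟩ : ∃ δ > 0, Metric.closedBall θ0 δ ⊆ Θ ∧
      ∀ θ ∈ Metric.closedBall θ0 δ, ∀ u, fderiv ℝ (fderiv ℝ Y) θ u u ≤ -χ * ‖u‖ ^ 2 := by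
    exact local_ball hΘopen hθ0 hχ cY hQ
  obtain ⟨D, hD, hdiam⟩ : ∃ D > 0, ∀ x ∈ Θ, ∀ y ∈ Θ, ‖x - y‖ ≤ D := by
    obtain ⟨D, hD, hb⟩ := hΘbdd.subset_closedBall_lt 0 θ0
    refine ⟨D + D, by positivity, fun x hx y hy => ?_⟩
    have a1 := hb hx
    have a2 := hb hy
    rw [Metric.mem_closedBall] at a1 a2
    rw [← dist_eq_norm]
    exact (dist_triangle_right x y θ0).trans (add_le_add a1 a2)
  have hδt : ∀ᶠ k in atTop, t k ∈ Metric.closedBall θ0 δ := ht (Metric.closedBall_mem_nhds θ0 hδ)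
  have htf : ∀ᶠ k in atTop, fderiv ℝ (h k) (t k) = 0 := by
    filter_upwards [hδt] with k hk
    apply IsLocalMax.fderiv_eq_zero
    filter_upwards [hΘopen.mem_nhds (hball hk)] with x hx
    exact htmax k x (subset_closure hx)
  set c := min (χ / 4) (χ * δ ^ 2 / (2 * D ^ 2)) with hc
  have hc0 : 0 < c := by positivity
  -- dominated bound
  have hbound : ∀ᶠ k in atTop, ∀ u, t k + r k • u ∈ Θ →
      h k (t k + r k • u) - h k (t k) ≤ -c * ‖u‖ ^ 2 := by
    have e1 : ∀ᶠ k in atTop, r k * M ≤ χ * δ ^ 2 / 2 := hrM.eventually (ge_mem_nhds (by positivity))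
    have e2 : ∀ᶠ k in atTop, η k ≤ χ / 2 := hη.eventually (ge_mem_nhds (by positivity))
    filter_upwards [e1, e2, hnpos, hnr2, htf, hδt] with k e1 e2 hnk hnr2 htf hδt u hu
    obtain ⟨U, hU, hΘU, hhk⟩ := hh k
    have := quad_bound q hΘbdd hU hΘU hhk hY hnk hχ hδ hD ((h2 k).trans e2) hθ0 hYneg hball hYδ hδt htf
      (htmax k) hdiam (hmul k _ hnk (h3 k)) e1 hu
    refine this.trans (le_of_eq ?_)
    rw [add_sub_cancel_left, norm_smul, Real.norm_eq_abs, mul_pow, sq_abs, ← hc]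
    linear_combination (-c * ‖u‖ ^ 2) * hnr2
  have hcs : ∀ k, Continuous fun u : EuclideanSpace ℝ (Fin q) => t k + r k • u := fun k => by fun_prop
  have hSmeas : ∀ k, MeasurableSet {u : EuclideanSpace ℝ (Fin q) | t k + r k • u ∈ Θ} := fun k =>
    (hΘopen.preimage (hcs k)).measurableSet
  -- positive definiteness
  set A : Matrix (Fin q) (Fin q) ℝ := Matrix.of fun i j => -(hessEntry q Y θ0 i j) with hAdef
  have hAq : ∀ u : EuclideanSpace ℝ (Fin q),
      ∑ i, ∑ j, u i * u j * A i j = - fderiv ℝ (fderiv ℝ Y) θ0 u u := fun u => by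
    rw [hess_expand]
    simp [hAdef, Finset.sum_neg_distrib]
  have hA : A.PosDef := by
    refine Matrix.PosDef.of_dotProduct_mulVec_pos ?_ fun x hx => ?_
    · ext i j
      have hs : IsSymmSndFDerivAt ℝ Y θ0 := hY.contDiffAt.isSymmSndFDerivAt (by simp)
      simp only [Matrix.conjTranspose_apply, hAdef, Matrix.of_apply, hessEntry,
        iteratedFDeriv_two_apply, star_trivial, Matrix.cons_val_zero, Matrix.cons_val_one]
      rw [hs.eq]
    · have e1 : star x ⬝ᵥ A *ᵥ x = ∑ i, ∑ j, (WithLp.toLp 2 x : EuclideanSpace ℝ (Fin q)) i *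
          (WithLp.toLp 2 x : EuclideanSpace ℝ (Fin q)) j * A i j := by
        simp only [dotProduct, Matrix.mulVec, Finset.mul_sum]
        refine Finset.sum_congr rfl fun i _ => Finset.sum_congr rfl fun j _ => ?_
        simp; ring
      rw [e1, hAq]
      have hx' : (WithLp.toLp 2 x : EuclideanSpace ℝ (Fin q)) ≠ 0 := by simpa using hx
      have := hQ (WithLp.toLp 2 x)
      have hp : 0 < ‖(WithLp.toLp 2 x : EuclideanSpace ℝ (Fin q))‖ := norm_pos_iff.mpr hx'
      have : 0 < χ * ‖(WithLp.toLp 2 x : EuclideanSpace ℝ (Fin q))‖ ^ 2 := by positivity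
      linarith
  have hlim : pri θ0 * (2 * Real.pi) ^ ((q : ℝ) / 2) * A.det ^ (-(1 : ℝ) / 2)
      = ∫ u : EuclideanSpace ℝ (Fin q), Real.exp (1 / 2 * fderiv ℝ (fderiv ℝ Y) θ0 u u) * pri θ0 := by
    rw [integral_mul_const, mul_assoc, ← gauss_int q A hA, mul_comm]
    congr 2
    ext u
    rw [hAq]
    ring_nf
  rw [hlim]
  have hind : ∀ k, (∫ u in {u : EuclideanSpace ℝ (Fin q) | t k + r k • u ∈ Θ},
        Real.exp (h k (t k + r k • u) - h k (t k)) * pri (t k + r k • u)) =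
      ∫ u, Set.indicator {u : EuclideanSpace ℝ (Fin q) | t k + r k • u ∈ Θ}
        (fun u => Real.exp (h k (t k + r k • u) - h k (t k)) * pri (t k + r k • u)) u := fun k =>
    (integral_indicator (hSmeas k)).symm
  change Tendsto (fun k => ∫ u in {u : EuclideanSpace ℝ (Fin q) | t k + r k • u ∈ Θ},
        Real.exp (h k (t k + r k • u) - h k (t k)) * pri (t k + r k • u)) atTop _
  simp only [hind]
  refine tendsto_integral_filter_of_dominated_convergence
    (fun u => Real.exp (-c * ‖u‖ ^ 2) * C) ?_ ?_ ?_ ?_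
  · refine Eventually.of_forall fun k => ?_
    apply Measurable.aestronglyMeasurable
    apply Measurable.indicator _ (hSmeas k)
    have m1 := (hmeas k).comp (hcs k).measurable
    have m2 := hpricont.measurable.comp (hcs k).measurable
    exact ((m1.sub_const _).exp).mul m2
  · filter_upwards [hbound] with k hk
    refine Eventually.of_forall fun u => ?_
    by_cases hu : t k + r k • u ∈ Θ
    · rw [Set.indicator_of_mem (by exact hu), Real.norm_eq_abs,
        abs_of_nonneg (mul_nonneg (Real.exp_pos _).le (hprinonneg _))]
      exact mul_le_mul (Real.exp_le_exp.mpr (hk u hu)) (hC _) (hprinonneg _) (Real.exp_pos _).le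
    · rw [Set.indicator_of_notMem (by exact hu), norm_zero]
      positivity
  · apply Integrable.mul_const
    have := GaussianFourier.integrable_cexp_neg_mul_sq_norm_add (V := EuclideanSpace ℝ (Fin q))
      (b := (c : ℂ)) (by simpa using hc0) 0 0
    refine this.norm.congr (Eventually.of_forall fun u => ?_)
    simp only [Complex.norm_exp]
    congr 1
    simp [← Complex.ofReal_pow, ← Complex.ofReal_mul, ← Complex.ofReal_neg]
  · refine Eventually.of_forall fun u => ?_
    have hto : Tendsto (fun k => t k + r k • u) atTop (nhds θ0) := by
      simpa using ht.add (hr.smul_const u)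
    have p1 := pointwise_lim q hΘbdd hΘopen hh hY hnpos hr hnr2 hη h2 hθ0 ht htf u
    have p2 := (hpricont.tendsto θ0).comp hto
    have p3 := ((Real.continuous_exp.tendsto _).comp p1).mul p2
    refine p3.congr' ?_
    filter_upwards [hto (hΘopen.mem_nhds hθ0)] with k hk
    rw [Set.indicator_of_mem (by exact hk)]
    rfl

/-- Equation (5.13): `∫_{Ûₙ} Ẑₙ(u) π(θ̂ₙ + n^{-1/2}u) du → π(θ₀) (2π)^{q/2} (det Γ(θ₀))^{-1/2}`
in probability, where `Γ(θ₀) = -Hess Y(θ₀)`. -/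
theorem stmt18
    {Ω : Type*} [MeasurableSpace Ω] (P : Measure Ω) [IsProbabilityMeasure P]
    (q : ℕ) (hq : 1 ≤ q)
    (Θ : Set (EuclideanSpace ℝ (Fin q)))
    (hΘne : Θ.Nonempty) (hΘbdd : Bornology.IsBounded Θ) (hΘopen : IsOpen Θ)
    (hΘconv : Convex ℝ Θ)
    (H : ℕ → Ω → EuclideanSpace ℝ (Fin q) → ℝ)
    (hHmeas : ∀ n, Measurable (fun p : Ω × EuclideanSpace ℝ (Fin q) => H n p.1 p.2))
    (hHsmooth : ∀ n ω, ∃ U : Set (EuclideanSpace ℝ (Fin q)),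
      IsOpen U ∧ closure Θ ⊆ U ∧ ContDiffOn ℝ 3 (H n ω) U)
    (θhat : ℕ → Ω → EuclideanSpace ℝ (Fin q))
    (hθhatmeas : ∀ n, Measurable (θhat n))
    (hθhatmem : ∀ n ω, θhat n ω ∈ closure Θ)
    (hθhatmax : ∀ n ω, ∀ θ ∈ closure Θ, H n ω θ ≤ H n ω (θhat n ω))
    (θ0 : EuclideanSpace ℝ (Fin q)) (hθ0 : θ0 ∈ Θ)
    (χ : ℝ) (hχ : 0 < χ)
    (Y : EuclideanSpace ℝ (Fin q) → ℝ) (hYsmooth : ContDiff ℝ 2 Y)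
    (hY0 : Y θ0 = 0)
    (hYneg : ∀ θ ∈ Θ, Y θ ≤ -χ * ‖θ - θ0‖ ^ 2)
    (pri : EuclideanSpace ℝ (Fin q) → ℝ)
    (hpricont : Continuous pri) (hpribdd : ∃ C, ∀ θ, pri θ ≤ C)
    (hprinonneg : ∀ θ, 0 ≤ pri θ) (hpripos : 0 < pri θ0)
    -- (i) √n (θ̂ₙ - θ₀) is bounded in probability
    (h1 : BoundedInProb P (fun n ω => Real.sqrt n * ‖θhat n ω - θ0‖))
    -- (ii) sup_{θ ∈ cl Θ} |Γₙ(θ) - Γ(θ)| → 0 in probability, Γ(θ) = -Hess Y(θ)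
    (h2 : ∀ ε > 0, Tendsto (fun n : ℕ =>
      P {ω | ε < ⨆ θ ∈ closure Θ, frobNorm q (fun i j =>
        (-(1 / (n : ℝ)) * hessEntry q (H n ω) θ i j) - (-(hessEntry q Y θ i j)))})
      atTop (nhds 0))
    -- (iii) √n sup_{θ ∈ cl Θ} |Yₙ(θ) - Y(θ)| is bounded in probability
    (h3 : BoundedInProb P (fun n ω =>
      Real.sqrt n * ⨆ θ ∈ closure Θ, |(1 / (n : ℝ)) * (H n ω θ - H n ω θ0) - Y θ|))
    -- (iv) (1/n) sup_{θ ∈ cl Θ} |∂³ Hₙ(θ)| is bounded in probability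
    (h4 : BoundedInProb P (fun n ω =>
      (1 / (n : ℝ)) * ⨆ θ ∈ closure Θ, thirdFrob q (H n ω) θ)) :
    TendstoInProb P (fun n ω =>
      ∫ u in {u : EuclideanSpace ℝ (Fin q) |
            θhat n ω + ((n : ℝ) ^ (-(1 : ℝ) / 2)) • u ∈ Θ},
        Real.exp (H n ω (θhat n ω + ((n : ℝ) ^ (-(1 : ℝ) / 2)) • u) - H n ω (θhat n ω)) *
          pri (θhat n ω + ((n : ℝ) ^ (-(1 : ℝ) / 2)) • u))
      (pri θ0 * (2 * Real.pi) ^ ((q : ℝ) / 2) *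
        (Matrix.det (Matrix.of fun i j => -(hessEntry q Y θ0 i j))) ^ (-(1 : ℝ) / 2)) := by
  have key : ∀ ε > 0, ∀ M : ℝ, ∃ δ > 0, ∃ N : ℕ, ∀ n ≥ N, ∀ ω,
      Real.sqrt n * ‖θhat n ω - θ0‖ ≤ M →
      (⨆ θ ∈ closure Θ, frobNorm q (fun i j =>
        (-(1 / (n : ℝ)) * hessEntry q (H n ω) θ i j) - (-(hessEntry q Y θ i j)))) ≤ δ →
      (Real.sqrt n * ⨆ θ ∈ closure Θ, |(1 / (n : ℝ)) * (H n ω θ - H n ω θ0) - Y θ|) ≤ M →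
      |(∫ u in {u : EuclideanSpace ℝ (Fin q) |
            θhat n ω + ((n : ℝ) ^ (-(1 : ℝ) / 2)) • u ∈ Θ},
        Real.exp (H n ω (θhat n ω + ((n : ℝ) ^ (-(1 : ℝ) / 2)) • u) - H n ω (θhat n ω)) *
          pri (θhat n ω + ((n : ℝ) ^ (-(1 : ℝ) / 2)) • u)) -
        (pri θ0 * (2 * Real.pi) ^ ((q : ℝ) / 2) *
        (Matrix.det (Matrix.of fun i j => -(hessEntry q Y θ0 i j))) ^ (-(1 : ℝ) / 2))| ≤ ε := by
    intro ε hε M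
    by_contra! hcon
    choose n hn ω g1 g2 g3 g4 using fun k : ℕ => hcon (1 / ((k : ℝ) + 1)) (by positivity) k
    have hnt : Tendsto n atTop atTop := tendsto_atTop_mono hn tendsto_id
    have := seq_lemma q Θ hΘbdd hΘopen (fun k => H (n k) (ω k))
      (fun k => (hHmeas (n k)).comp measurable_prodMk_left)
      (fun k => hHsmooth _ _) (fun k => θhat (n k) (ω k)) (fun k => hθhatmax _ _) θ0 hθ0 χ hχ Y
      hYsmooth hY0 hYneg pri hpricont hpribdd hprinonneg n hnt M _
      tendsto_one_div_add_atTop_nhds_zero_nat g1 g2 g3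
    obtain ⟨k, hk⟩ := (Metric.tendsto_nhds.mp this ε hε).exists
    rw [Real.dist_eq] at hk
    exact absurd hk (not_lt.mpr (g4 k).le)
  have bip : ∀ X : ℕ → Ω → ℝ, BoundedInProb P X → ∀ e : ℝ, 0 < e → ∃ M : ℝ,
      ∀ᶠ n in atTop, P {ω | M < |X n ω|} < ENNReal.ofReal e := by
    intro X hX e he
    obtain ⟨M, -, hM⟩ := hX (e / 2) (by positivity)
    refine ⟨M, eventually_lt_of_limsup_lt (hM.trans_lt ?_)⟩
    exact (ENNReal.ofReal_lt_ofReal_iff he).mpr (by linarith)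
  intro ε hε
  rw [ENNReal.tendsto_nhds_zero]
  intro e he
  obtain ⟨e', he'0, he'⟩ : ∃ e' : ℝ, 0 < e' ∧ ENNReal.ofReal e' * 3 ≤ e := by
    by_cases htop : e = ⊤
    · exact ⟨1, one_pos, by simp [htop]⟩
    · refine ⟨e.toReal / 3, by have := ENNReal.toReal_pos he.ne' htop; positivity, ?_⟩
      rw [← ENNReal.ofReal_ofNat 3, ← ENNReal.ofReal_mul (by positivity)]
      rw [div_mul_cancel₀ _ (by norm_num), ENNReal.ofReal_toReal htop]
  obtain ⟨M1, hM1⟩ := bip _ h1 e' he'0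
  obtain ⟨M3, hM3⟩ := bip _ h3 e' he'0
  obtain ⟨δ, hδ, N, hN⟩ := key ε hε (max M1 M3)
  have hM2 := (h2 δ hδ).eventually (gt_mem_nhds (ENNReal.ofReal_pos.mpr he'0))
  filter_upwards [hM1, hM3, hM2, eventually_ge_atTop N] with n a1 a3 a2 hn
  refine le_trans ?_ he'
  refine (measure_mono (t := ({ω | M1 < |Real.sqrt n * ‖θhat n ω - θ0‖|} ∪
    {ω | δ < ⨆ θ ∈ closure Θ, frobNorm q (fun i j =>
        (-(1 / (n : ℝ)) * hessEntry q (H n ω) θ i j) - (-(hessEntry q Y θ i j)))}) ∪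
    {ω | M3 < |Real.sqrt n * (⨆ θ ∈ closure Θ,
      |(1 / (n : ℝ)) * (H n ω θ - H n ω θ0) - Y θ|)|}) ?_).trans ?_
  · intro ω hω
    by_contra hcon
    simp only [Set.mem_union, Set.mem_setOf_eq, not_or, not_lt] at hcon
    obtain ⟨⟨b1, b2⟩, b3⟩ := hcon
    have := hN n hn ω ((le_abs_self _).trans (b1.trans (le_max_left _ _))) b2
      ((le_abs_self _).trans (b3.trans (le_max_right _ _)))
    exact absurd hω (not_lt.mpr this)
  · refine (measure_union_le _ _).trans ((add_le_add (measure_union_le _ _) le_rfl).trans ?_)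
    refine (add_le_add (add_le_add a1.le a2.le) a3.le).trans (le_of_eq ?_)
    ring

end
end
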